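/- arXiv:1407.7334 — 3 statements merged into one kernel-verified Lean document; each statement's English description precedes it below -/
import Mathlib

section
/- For every integer n ≥ 1, every α > 0 and every t > 0, the map t ↦ γ_n(t) is differentiable and satisfies 2t (d/dt) ln γ_n(t) = a_n(t), where a_n(t) = α_n(t) − (2n + 1 + α). -/
open MeasureTheory Set Filter Topology Polynomial

/-- The singularly perturbed Laguerre weight `x ^ α * exp (-x - t / x)`. -/
noncomputable def singLaguerreWeight (α t x : ℝ) : ℝ := x ^ α * Real.exp (-x - t / x)

theorem singLaguerreWeight_nonneg (α t : ℝ) {x : ℝ} (hx : 0 ≤ x) :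
    0 ≤ singLaguerreWeight α t x :=
  mul_nonneg (Real.rpow_nonneg hx _) (Real.exp_nonneg _)

theorem singLaguerreWeight_le (α : ℝ) {t x : ℝ} (ht : 0 ≤ t) (hx : 0 ≤ x) :
    singLaguerreWeight α t x ≤ x ^ α * Real.exp (-x) := by
  have : 0 ≤ t / x := div_nonneg ht hx
  exact mul_le_mul_of_nonneg_left (Real.exp_le_exp.2 (by linarith)) (Real.rpow_nonneg hx _)

theorem continuousOn_singLaguerreWeight (α t : ℝ) :
    ContinuousOn (singLaguerreWeight α t) (Ioi 0) := by
  intro x hx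
  have hx0 : x ≠ 0 := (mem_Ioi.1 hx).ne'
  refine ContinuousAt.continuousWithinAt ?_
  unfold singLaguerreWeight
  exact (Real.continuousAt_rpow_const _ _ (Or.inl hx0)).mul (by fun_prop (disch := exact hx0))

theorem aestronglyMeasurable_eval_mul_singLaguerreWeight (q : ℝ[X]) (α t : ℝ) :
    AEStronglyMeasurable (fun x => q.eval x * singLaguerreWeight α t x)
      (volume.restrict (Ioi 0)) :=
  (q.continuous.continuousOn.mul (continuousOn_singLaguerreWeight α t)).aestronglyMeasurable
    measurableSet_Ioi

theorem integrableOn_eval_mul_rpow_mul_exp (q : ℝ[X]) {α : ℝ} (hα : -1 < α) :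
    IntegrableOn (fun x => q.eval x * (x ^ α * Real.exp (-x))) (Ioi 0) := by
  induction q using Polynomial.induction_on' with
  | add p q hp hq =>
    refine (hp.add hq).congr (ae_of_all _ fun x => ?_)
    simp [add_mul]
  | monomial k c =>
    have hk : 0 < α + k + 1 := by linarith [(Nat.cast_nonneg k : (0 : ℝ) ≤ k)]
    refine IntegrableOn.congr_fun ((Real.GammaIntegral_convergent hk).const_mul c) ?_
      measurableSet_Ioi
    intro x hx
    have hx : 0 < x := hx
    simp only [eval_monomial]
    rw [add_sub_cancel_right, Real.rpow_add hx, Real.rpow_natCast]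
    ring

theorem integrableOn_eval_mul_singLaguerreWeight (q : ℝ[X]) {α t : ℝ} (hα : -1 < α)
    (ht : 0 ≤ t) : IntegrableOn (fun x => q.eval x * singLaguerreWeight α t x) (Ioi 0) := by
  refine Integrable.mono (integrableOn_eval_mul_rpow_mul_exp q hα)
    (aestronglyMeasurable_eval_mul_singLaguerreWeight q α t) ?_
  filter_upwards [ae_restrict_mem measurableSet_Ioi] with x hx
  have hx : 0 < x := hx
  rw [norm_mul, norm_mul, Real.norm_of_nonneg (singLaguerreWeight_nonneg α t hx.le),
    Real.norm_of_nonneg (by positivity : 0 ≤ x ^ α * Real.exp (-x))]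
  exact mul_le_mul_of_nonneg_left (singLaguerreWeight_le α ht hx.le) (norm_nonneg _)

/-- Integration of polynomials against the singularly perturbed Laguerre weight. -/
noncomputable def laguerreFunctional {α t : ℝ} (hα : -1 < α) (ht : 0 ≤ t) : ℝ[X] →ₗ[ℝ] ℝ where
  toFun q := ∫ x in Ioi (0 : ℝ), q.eval x * singLaguerreWeight α t x
  map_add' p q := by
    simp only [eval_add, add_mul]
    exact integral_add (integrableOn_eval_mul_singLaguerreWeight p hα ht)
      (integrableOn_eval_mul_singLaguerreWeight q hα ht)
  map_smul' c q := by
    simp only [eval_smul, smul_eq_mul, mul_assoc, RingHom.id_apply]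
    exact integral_const_mul _ _

theorem laguerreFunctional_apply {α t : ℝ} (hα : -1 < α) (ht : 0 ≤ t) (q : ℝ[X]) :
    laguerreFunctional hα ht q = ∫ x in Ioi (0 : ℝ), q.eval x * singLaguerreWeight α t x :=
  rfl

theorem hasDerivAt_singLaguerreWeight_param (α t : ℝ) {x : ℝ} (hx : 0 < x) :
    HasDerivAt (fun s => singLaguerreWeight α s x) (-singLaguerreWeight (α - 1) t x) t := by
  unfold singLaguerreWeight
  have h := ((((hasDerivAt_id t).div_const x).const_sub (-x)).exp).const_mul (x ^ α)
  refine h.congr_deriv ?_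
  rw [Real.rpow_sub_one hx.ne']
  simp only [id]
  ring

theorem hasDerivAt_singLaguerreWeight (α t : ℝ) {x : ℝ} (hx : 0 < x) :
    HasDerivAt (fun y => y * singLaguerreWeight α t y)
      ((1 + α - x) * singLaguerreWeight α t x + t * singLaguerreWeight (α - 1) t x) x := by
  unfold singLaguerreWeight
  have h1 : HasDerivAt (fun y : ℝ => -y - t / y) (-1 + t / x ^ 2) x := by
    have := (hasDerivAt_id x).neg.sub ((hasDerivAt_inv hx.ne').const_mul t)
    simp only [div_eq_mul_inv]
    refine this.congr_deriv ?_
    ring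
  have h := (hasDerivAt_id x).mul
    ((Real.hasDerivAt_rpow_const (p := α) (Or.inl hx.ne')).mul h1.exp)
  refine h.congr_deriv ?_
  simp only [id, Pi.mul_apply]
  rw [Real.rpow_sub_one hx.ne']
  field_simp
  ring

theorem hasDerivAt_integral_eval_mul_singLaguerreWeight (q : ℝ[X]) {α t : ℝ} (hα : 0 < α)
    (ht : 0 < t) :
    HasDerivAt (fun s => ∫ x in Ioi (0 : ℝ), q.eval x * singLaguerreWeight α s x)
      (-∫ x in Ioi (0 : ℝ), q.eval x * singLaguerreWeight (α - 1) t x) t := by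
  have hα' : -1 < α - 1 := by linarith
  rw [← integral_neg]
  refine (hasDerivAt_integral_of_dominated_loc_of_deriv_le (s := Ioi 0)
    (F' := fun s x => -(q.eval x * singLaguerreWeight (α - 1) s x))
    (bound := fun x => ‖q.eval x * (x ^ (α - 1) * Real.exp (-x))‖)
    (Ioi_mem_nhds ht) (Eventually.of_forall fun s =>
      aestronglyMeasurable_eval_mul_singLaguerreWeight q α s)
    (integrableOn_eval_mul_singLaguerreWeight q (by linarith) ht.le)
    (aestronglyMeasurable_eval_mul_singLaguerreWeight q (α - 1) t).neg ?_
    (integrableOn_eval_mul_rpow_mul_exp q hα').norm ?_).2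
  · filter_upwards [ae_restrict_mem measurableSet_Ioi] with x hx s hs
    have hx : 0 < x := hx
    have hs : 0 < s := hs
    rw [norm_neg, norm_mul, norm_mul, Real.norm_of_nonneg (singLaguerreWeight_nonneg _ s hx.le),
      Real.norm_of_nonneg (by positivity : 0 ≤ x ^ (α - 1) * Real.exp (-x))]
    exact mul_le_mul_of_nonneg_left (singLaguerreWeight_le _ hs.le hx.le) (norm_nonneg _)
  · filter_upwards [ae_restrict_mem measurableSet_Ioi] with x hx s hs
    refine ((hasDerivAt_singLaguerreWeight_param α s hx).const_mul (q.eval x)).congr_deriv ?_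
    ring

theorem tendsto_eval_mul_rpow_mul_exp_atTop (q : ℝ[X]) (α : ℝ) :
    Tendsto (fun x => q.eval x * (x ^ α * Real.exp (-x))) atTop (𝓝 0) := by
  induction q using Polynomial.induction_on' with
  | add p q hp hq => simpa [add_mul] using hp.add hq
  | monomial k c =>
    have h := (tendsto_rpow_mul_exp_neg_mul_atTop_nhds_zero (k + α) 1 one_pos).const_mul c
    rw [mul_zero] at h
    refine h.congr' ?_
    filter_upwards [eventually_gt_atTop 0] with x hx
    rw [Real.rpow_add hx, Real.rpow_natCast, eval_monomial, neg_one_mul]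
    ring

/-- Integrating the derivative of `x * q x * w x` gives zero. -/
theorem laguerreFunctional_integration_by_parts {α t : ℝ} (hα : -1 < α) (hα₀ : 0 < α)
    (hα' : -1 < α - 1) (ht : 0 ≤ t) (q : ℝ[X]) :
    laguerreFunctional hα ht (X * derivative q + (C (1 + α) - X) * q)
      + t * laguerreFunctional hα' ht q = 0 := by
  rw [laguerreFunctional_apply, laguerreFunctional_apply, ← integral_const_mul,
    ← integral_add (integrableOn_eval_mul_singLaguerreWeight _ hα ht)
      ((integrableOn_eval_mul_singLaguerreWeight _ hα' ht).const_mul t)]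
  have key := integral_Ioi_of_hasDerivAt_of_tendsto (a := (0 : ℝ)) (m := (0 : ℝ))
    (f := fun x => q.eval x * (x * singLaguerreWeight α t x))
    (f' := fun x => (X * derivative q + (C (1 + α) - X) * q).eval x * singLaguerreWeight α t x
      + t * (q.eval x * singLaguerreWeight (α - 1) t x)) ?_ ?_ ?_ ?_
  · simpa using key
  · have hlim : Tendsto (fun x : ℝ => |q.eval x| * (x * x ^ α)) (𝓝[Ici 0] 0) (𝓝 0) := by
      have hc : Continuous fun x : ℝ => |q.eval x| * (x * x ^ α) :=
        q.continuous.abs.mul (continuous_id.mul (Real.continuous_rpow_const hα₀.le))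
      have := hc.tendsto 0
      simp only [zero_mul, mul_zero] at this
      exact this.mono_left nhdsWithin_le_nhds
    have h0 : q.eval 0 * ((0 : ℝ) * singLaguerreWeight α t 0) = 0 := by simp
    unfold ContinuousWithinAt
    beta_reduce
    rw [h0]
    refine squeeze_zero_norm' ?_ hlim
    filter_upwards [self_mem_nhdsWithin] with x hx
    have hx : 0 ≤ x := hx
    rw [norm_mul, Real.norm_eq_abs, Real.norm_of_nonneg
      (mul_nonneg hx (singLaguerreWeight_nonneg α t hx))]
    refine mul_le_mul_of_nonneg_left (mul_le_mul_of_nonneg_left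
      ((singLaguerreWeight_le α ht hx).trans ?_) hx) (abs_nonneg _)
    exact mul_le_of_le_one_right (Real.rpow_nonneg hx _) (Real.exp_le_one_iff.2 (by linarith))
  · intro x hx
    refine ((q.hasDerivAt x).mul (hasDerivAt_singLaguerreWeight α t hx)).congr_deriv ?_
    simp only [eval_add, eval_mul, eval_sub, eval_X, eval_C]
    ring
  · exact (integrableOn_eval_mul_singLaguerreWeight _ hα ht).add
      ((integrableOn_eval_mul_singLaguerreWeight _ hα' ht).const_mul t)
  · have hlim := (tendsto_eval_mul_rpow_mul_exp_atTop (X * q) α).norm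
    rw [norm_zero] at hlim
    refine squeeze_zero_norm' ?_ hlim
    filter_upwards [eventually_ge_atTop 0] with x hx
    rw [show q.eval x * (x * singLaguerreWeight α t x)
        = (X * q).eval x * singLaguerreWeight α t x by rw [eval_mul, eval_X]; ring,
      norm_mul, norm_mul, Real.norm_of_nonneg (singLaguerreWeight_nonneg α t hx),
      Real.norm_of_nonneg (mul_nonneg (Real.rpow_nonneg hx _) (Real.exp_nonneg _))]
    exact mul_le_mul_of_nonneg_left (singLaguerreWeight_le α ht hx) (norm_nonneg _)

/-- Pairing a polynomial of degree at most `n` with the `n`-th monic orthogonal polynomial. -/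
theorem functional_mul_orthogonal {L : ℝ[X] →ₗ[ℝ] ℝ} {p : ℕ → ℝ[X]} {H : ℕ → ℝ}
    (hp : ∀ m, (p m).Monic) (hdeg : ∀ m, (p m).natDegree = m)
    (hL : ∀ j k, L (p j * p k) = if j = k then H j else 0) {n : ℕ} {q : ℝ[X]}
    (hq : q.natDegree ≤ n) : L (q * p n) = q.coeff n * H n := by
  have hcoeff : ∀ m, (p m).coeff m = 1 := fun m => by
    simpa [hdeg m] using (hp m).coeff_natDegree
  have hlow : ∀ d ≤ n, ∀ q : ℝ[X], (∀ m, d ≤ m → q.coeff m = 0) → L (q * p n) = 0 := by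
    intro d
    induction d with
    | zero =>
      intro _ q hq
      have : q = 0 := by ext m; simp [hq m (Nat.zero_le m)]
      simp [this]
    | succ d ih =>
      intro hd q hq
      have h1 := ih (by omega) (q - q.coeff d • p d) fun m hm => by
        rcases hm.eq_or_lt with rfl | hm
        · simp [hcoeff]
        · simp [hq m hm, coeff_eq_zero_of_natDegree_lt ((hdeg d).trans_lt hm)]
      rw [sub_mul, smul_mul_assoc, map_sub, map_smul, hL, if_neg (by omega)] at h1
      simpa using h1
  have h1 := hlow n le_rfl (q - q.coeff n • p n) fun m hm => by
    rcases hm.eq_or_lt with rfl | hm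
    · simp [hcoeff]
    · simp [coeff_eq_zero_of_natDegree_lt (hq.trans_lt hm),
        coeff_eq_zero_of_natDegree_lt ((hdeg n).trans_lt hm)]
  rw [sub_mul, smul_mul_assoc, map_sub, map_smul, hL, if_pos rfl, smul_eq_mul] at h1
  linarith

/-- A function squeezed between two functions that touch to first order is differentiable. -/
theorem HasDerivAt.of_le_of_le {f l u : ℝ → ℝ} {d x : ℝ} (hl : HasDerivAt l d x)
    (hu : HasDerivAt u d x) (hlx : l x = f x) (hux : u x = f x)
    (hlf : ∀ᶠ y in 𝓝 x, l y ≤ f y) (hfu : ∀ᶠ y in 𝓝 x, f y ≤ u y) : HasDerivAt f d x := by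
  have hk : HasDerivAt (u - l) 0 x := by simpa using hu.sub hl
  have he : HasDerivAt (f - l) 0 x := by
    rw [hasDerivAt_iff_isLittleO] at hk ⊢
    refine Asymptotics.IsBigO.trans_isLittleO (Asymptotics.IsBigO.of_bound 1 ?_) hk
    filter_upwards [hlf, hfu] with y h1 h2
    simp only [Pi.sub_apply, hlx, hux, sub_self, smul_zero, sub_zero, Real.norm_eq_abs, one_mul]
    exact abs_le_abs_of_nonneg (by linarith) (by linarith)
  simpa using he.add hl

theorem singLaguerreWeight_mul_symm (α t s : ℝ) {x : ℝ} :
    singLaguerreWeight α s x * singLaguerreWeight α (2 * t - s) x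
      = singLaguerreWeight α t x ^ 2 := by
  unfold singLaguerreWeight
  rw [mul_mul_mul_comm, ← Real.exp_add, mul_pow, ← Real.exp_nat_mul, ← sq]
  congr 2
  push_cast
  ring

/-- For every integer `n ≥ 1`, `α > 0`, `t > 0`, the map `t ↦ γ_n(t)` is
differentiable and satisfies `2t (d/dt) ln γ_n(t) = a_n(t)`, where
`a_n(t) = α_n(t) - (2n + 1 + α)` and `γ_n(t) = h_n(t)^{-1/2}`. -/
theorem log_derivative_leading_coeff
    (α : ℝ) (hα : 0 < α) (t : ℝ) (ht : 0 < t) (n : ℕ) (hn : 1 ≤ n)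
    (P : ℕ → ℝ → ℝ → ℝ) (h : ℕ → ℝ → ℝ) (A B : ℕ → ℝ → ℝ)
    (hmonic : ∀ m : ℕ, ∀ τ > (0:ℝ), ∃ p : Polynomial ℝ,
      p.Monic ∧ p.natDegree = m ∧ ∀ x, P m τ x = p.eval x)
    (horth : ∀ j k : ℕ, ∀ τ > (0:ℝ),
      (∫ x in Ioi (0:ℝ), P j τ x * P k τ x * (x ^ α * Real.exp (-x - τ / x)))
        = if j = k then h j τ else 0)
    (hpos : ∀ j : ℕ, ∀ τ > (0:ℝ), 0 < h j τ)
    (hrec : ∀ m : ℕ, 1 ≤ m → ∀ τ > (0:ℝ), ∀ x : ℝ,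
      x * P m τ x = P (m + 1) τ x + A m τ * P m τ x + B m τ * P (m - 1) τ x) :
    DifferentiableAt ℝ (fun τ => (h n τ) ^ (-(1:ℝ) / 2)) t ∧
    2 * t * deriv (fun τ => Real.log ((h n τ) ^ (-(1:ℝ) / 2))) t
      = A n t - (2 * n + 1 + α) := by
  have hα1 : -1 < α := by linarith
  have hα2 : -1 < α - 1 := by linarith
  choose p hp hdeg heval using hmonic
  have hL : ∀ τ (hτ : 0 < τ) j k,
      laguerreFunctional hα1 hτ.le (p j τ hτ * p k τ hτ) = if j = k then h j τ else 0 := by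
    intro τ hτ j k
    rw [← horth j k τ hτ, laguerreFunctional_apply]
    simp only [eval_mul, heval _ τ hτ, singLaguerreWeight]
  have hpair : ∀ τ (hτ : 0 < τ) (q : ℝ[X]), q.natDegree ≤ n →
      laguerreFunctional hα1 hτ.le (q * p n τ hτ) = q.coeff n * h n τ := fun τ hτ q hq =>
    functional_mul_orthogonal (fun m => hp m τ hτ) (fun m => hdeg m τ hτ) (hL τ hτ) hq
  have hcoeff : ∀ τ (hτ : 0 < τ), (p n τ hτ).coeff n = 1 := fun τ hτ => by
    have := (hp n τ hτ).coeff_natDegree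
    rwa [hdeg] at this
  set π := p n t ht with hπ
  set G : ℝ → ℝ := fun s => ∫ x in Ioi (0 : ℝ), (π * π).eval x * singLaguerreWeight α s x with hG
  have hGL : ∀ s (hs : 0 < s), G s = laguerreFunctional hα1 hs.le (π * π) := fun _ _ => rfl
  have hGt : G t = h n t := by rw [hGL t ht, hL, if_pos rfl]
  have hupper : ∀ s, 0 < s → h n s ≤ G s := by
    intro s hs
    have h1 : laguerreFunctional hα1 hs.le (π * p n s hs) = h n s := by
      rw [hpair s hs π (hdeg n t ht).le, hcoeff t ht, one_mul]
    have h2 : 0 ≤ laguerreFunctional hα1 hs.le ((π - p n s hs) * (π - p n s hs)) := by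
      refine setIntegral_nonneg measurableSet_Ioi fun x hx => ?_
      rw [eval_mul]
      exact mul_nonneg (mul_self_nonneg _) (singLaguerreWeight_nonneg α s (le_of_lt hx))
    rw [show (π - p n s hs) * (π - p n s hs)
        = π * π - π * p n s hs - π * p n s hs + p n s hs * p n s hs by ring,
      map_add, map_sub, map_sub, h1, hL, if_pos rfl, ← hGL s hs] at h2
    linarith
  have hlower : ∀ s, 0 < s → s < 2 * t → 2 * h n t - G (2 * t - s) ≤ h n s := by
    intro s hs hst
    have hs' : 0 < 2 * t - s := by linarith
    have h1 : laguerreFunctional hα1 ht.le (p n s hs * π) = h n t := by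
      rw [hpair t ht _ (hdeg n s hs).le, hcoeff s hs, one_mul]
    have h2 : h n s = laguerreFunctional hα1 hs.le (p n s hs * p n s hs) := by
      rw [hL, if_pos rfl]
    rw [sub_le_iff_le_add, h2, hGL _ hs', ← h1, laguerreFunctional_apply, laguerreFunctional_apply,
      laguerreFunctional_apply, ← integral_const_mul,
      ← integral_add (integrableOn_eval_mul_singLaguerreWeight _ hα1 hs.le)
        (integrableOn_eval_mul_singLaguerreWeight _ hα1 hs'.le)]
    refine setIntegral_mono_on
      ((integrableOn_eval_mul_singLaguerreWeight _ hα1 ht.le).const_mul 2)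
      ((integrableOn_eval_mul_singLaguerreWeight _ hα1 hs.le).add
        (integrableOn_eval_mul_singLaguerreWeight _ hα1 hs'.le)) measurableSet_Ioi fun x hx => ?_
    simp only [eval_mul]
    have hw := singLaguerreWeight_nonneg α s (le_of_lt hx)
    have hw' := singLaguerreWeight_nonneg α (2 * t - s) (le_of_lt hx)
    have hm := singLaguerreWeight_mul_symm α t s (x := x)
    have hsqrt : √(singLaguerreWeight α s x) * √(singLaguerreWeight α (2 * t - s) x)
        = singLaguerreWeight α t x := by
      rw [← Real.sqrt_mul hw, hm, Real.sqrt_sq (singLaguerreWeight_nonneg α t (le_of_lt hx))]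
    have h3 := sq_nonneg ((p n s hs).eval x * √(singLaguerreWeight α s x)
      - π.eval x * √(singLaguerreWeight α (2 * t - s) x))
    rw [sub_sq, mul_pow, mul_pow, Real.sq_sqrt hw, Real.sq_sqrt hw'] at h3
    rw [← hsqrt]
    linarith
  set K := laguerreFunctional hα2 ht.le (π * π) with hK
  have hGd : HasDerivAt G (-K) t :=
    hasDerivAt_integral_eval_mul_singLaguerreWeight (π * π) hα ht
  have hhd : HasDerivAt (h n) (-K) t := by
    refine HasDerivAt.of_le_of_le (l := fun s => 2 * h n t - G (2 * t - s)) ?_ hGd ?_ hGt ?_ ?_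
    · have hi : HasDerivAt (fun s => 2 * t - s) (-1) t := (hasDerivAt_id t).const_sub _
      have hc : HasDerivAt (fun s => G (2 * t - s)) (-K * -1) t :=
        HasDerivAt.comp t (h₂ := G) (by rwa [show 2 * t - t = t by ring]) hi
      simpa using hc.const_sub (2 * h n t)
    · simp only [show 2 * t - t = t by ring, hGt]
      ring
    · filter_upwards [Ioo_mem_nhds ht (by linarith : t < 2 * t)] with s hs
      exact hlower s hs.1 hs.2
    · filter_upwards [Ioi_mem_nhds ht] with s hs
      exact hupper s hs
  have hht := hpos n t ht
  refine ⟨(hhd.rpow_const (Or.inl hht.ne')).differentiableAt, ?_⟩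
  have hlog : (fun τ => Real.log ((h n τ) ^ (-(1 : ℝ) / 2)))
      =ᶠ[𝓝 t] fun τ => -(1 : ℝ) / 2 * Real.log (h n τ) := by
    filter_upwards [Ioi_mem_nhds ht] with s hs
    exact Real.log_rpow (hpos n s hs) _
  rw [hlog.deriv_eq, ((hhd.log hht.ne').const_mul _).deriv]
  have hparts := laguerreFunctional_integration_by_parts hα1 hα hα2 ht.le (π * π)
  have hpoly : X * π = p (n + 1) t ht + A n t • π + B n t • p (n - 1) t ht := by
    refine Polynomial.funext fun x => ?_
    have := hrec n hn t ht x
    simp only [heval _ t ht] at this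
    simpa [hπ] using this
  have hX : laguerreFunctional hα1 ht.le (X * π * π) = A n t * h n t := by
    rw [hpoly, add_mul, add_mul, smul_mul_assoc, smul_mul_assoc, map_add, map_add, map_smul,
      map_smul, hπ, hL, hL, hL, if_neg (by omega), if_pos rfl, if_neg (by omega)]
    simp
  have hD : laguerreFunctional hα1 ht.le (X * derivative π * π) = n * h n t := by
    obtain ⟨m, rfl⟩ : ∃ m, n = m + 1 := ⟨n - 1, by omega⟩
    rw [hpair t ht, coeff_X_mul, coeff_derivative, hcoeff t ht]
    · push_cast
      ring
    · refine natDegree_mul_le.trans ?_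
      have h1 := natDegree_derivative_le π
      have h2 : π.natDegree = m + 1 := hdeg _ t ht
      rw [h2] at h1
      rw [natDegree_X]
      omega
  have hnorm : laguerreFunctional hα1 ht.le (π * π) = h n t := by rw [hL, if_pos rfl]
  rw [show X * derivative (π * π) + (C (1 + α) - X) * (π * π)
      = X * derivative π * π + X * derivative π * π + (1 + α) • (π * π) - X * π * π by
        rw [derivative_mul, smul_eq_C_mul]; ring,
    map_sub, map_add, map_add, map_smul, hX, hD, hnorm, ← hK, smul_eq_mul] at hparts
  field_simp
  linarith
end

section
/- (Chen–Its) For every integer n ≥ 1 and every α > 0, the function a_n(t) = α_n(t) − (2n + 1 + α) is twice continuously differentiable on (0, ∞) and satisfies the Painlevé III equation a_n''(t) = (a_n'(t))²/a_n(t) − a_n'(t)/t + (2n + 1 + α) a_n(t)²/t² + a_n(t)³/t² + α/t − 1/a_n(t) for all t > 0, with the initial conditions lim_{t→0⁺} a_n(t) = 0 and lim_{t→0⁺} a_n(t)/t = 1/α. -/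
open MeasureTheory Set Filter Topology

namespace PerturbedLaguerre

noncomputable section

/-- The singularly perturbed Laguerre weight `x ^ s * exp (-x - t / x)`. -/
def weight (s t x : ℝ) : ℝ := x ^ s * Real.exp (-x - t / x)

/-- The total mass of the perturbed Laguerre weight on `(0, ∞)`. -/
def moment (s t : ℝ) : ℝ := ∫ x in Ioi (0 : ℝ), weight s t x

theorem weight_pos (s t : ℝ) {x : ℝ} (hx : 0 < x) : 0 < weight s t x :=
  mul_pos (Real.rpow_pos_of_pos hx s) (Real.exp_pos _)

theorem weight_succ (s t : ℝ) {x : ℝ} (hx : 0 < x) : weight (s + 1) t x = x * weight s t x := by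
  rw [weight, weight, Real.rpow_add_one hx.ne']
  ring

theorem weight_pred (s t : ℝ) {x : ℝ} (hx : 0 < x) : weight (s - 1) t x = weight s t x / x := by
  rw [weight, weight, Real.rpow_sub_one hx.ne']
  ring

theorem weight_add_nat (s t : ℝ) (i : ℕ) {x : ℝ} (hx : 0 < x) :
    weight (s + i) t x = x ^ i * weight s t x := by
  rw [weight, weight, Real.rpow_add_natCast hx.ne']
  ring

theorem weight_le_weight (s : ℝ) {t u x : ℝ} (hx : 0 < x) (h : t ≤ u) :
    weight s u x ≤ weight s t x := by
  unfold weight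
  gcongr

theorem aestronglyMeasurable_weight (s t : ℝ) :
    AEStronglyMeasurable (weight s t) (volume.restrict (Ioi 0)) := by
  refine Measurable.aestronglyMeasurable ?_
  unfold weight
  fun_prop

theorem integrableOn_weight_zero {s : ℝ} (hs : -1 < s) :
    IntegrableOn (weight s 0) (Ioi 0) := by
  refine (Real.GammaIntegral_convergent (s := s + 1) (by linarith)).congr_fun ?_ measurableSet_Ioi
  intro x _
  simp [weight, mul_comm]

theorem integrableOn_weight {s t : ℝ} (hs : -1 < s) (ht : 0 ≤ t) :
    IntegrableOn (weight s t) (Ioi 0) := by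
  refine (integrableOn_weight_zero hs).mono' (aestronglyMeasurable_weight s t) ?_
  filter_upwards [ae_restrict_mem measurableSet_Ioi] with x hx
  rw [Real.norm_of_nonneg (weight_pos s t hx).le]
  exact weight_le_weight s hx ht

theorem weight_le_mul_weight_zero (s : ℝ) {t x : ℝ} (ht : 0 < t) (hx : 0 < x) (k : ℕ) :
    weight s t x ≤ k.factorial / t ^ k * weight (s + k) 0 x := by
  have h := Real.pow_div_factorial_le_exp (t / x) (by positivity) k
  have h2 : Real.exp (-(t / x)) ≤ k.factorial / t ^ k * x ^ k := by
    rw [Real.exp_neg]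
    calc (Real.exp (t / x))⁻¹ ≤ ((t / x) ^ k / k.factorial)⁻¹ := by gcongr
      _ = _ := by rw [div_pow]; field_simp
  rw [weight_add_nat _ _ _ hx, weight, weight, sub_eq_add_neg, Real.exp_add]
  calc x ^ s * (Real.exp (-x) * Real.exp (-(t / x)))
      ≤ x ^ s * (Real.exp (-x) * (k.factorial / t ^ k * x ^ k)) := by gcongr
    _ = _ := by simp; ring

theorem integrableOn_weight_of_pos (s : ℝ) {t : ℝ} (ht : 0 < t) :
    IntegrableOn (weight s t) (Ioi 0) := by
  obtain ⟨k, hk⟩ := exists_nat_gt (-1 - s)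
  refine ((integrableOn_weight_zero (s := s + k) (by linarith)).const_mul
    (k.factorial / t ^ k)).mono' (aestronglyMeasurable_weight s t) ?_
  filter_upwards [ae_restrict_mem measurableSet_Ioi] with x hx
  rw [Real.norm_of_nonneg (weight_pos s t hx).le]
  exact weight_le_mul_weight_zero s ht hx k

theorem continuousOn_moment {s : ℝ} (hs : -1 < s) : ContinuousOn (moment s) (Ici 0) := by
  refine continuousOn_of_dominated (bound := weight s 0)
    (fun t _ => aestronglyMeasurable_weight s t) ?_ (integrableOn_weight_zero hs) ?_
  · intro t ht
    filter_upwards [ae_restrict_mem measurableSet_Ioi] with x hx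
    rw [Real.norm_of_nonneg (weight_pos s t hx).le]
    exact weight_le_weight s hx ht
  · filter_upwards with x
    unfold weight
    fun_prop

theorem hasDerivAt_moment (s : ℝ) {t : ℝ} (ht : 0 < t) :
    HasDerivAt (moment s) (-moment (s - 1) t) t := by
  have key := hasDerivAt_integral_of_dominated_loc_of_deriv_le
    (μ := volume.restrict (Ioi (0 : ℝ))) (F := weight s) (x₀ := t)
    (F' := fun u x => -weight (s - 1) u x) (bound := weight (s - 1) (t / 2))
    (Ioi_mem_nhds (half_lt_self ht)) (Eventually.of_forall (aestronglyMeasurable_weight s))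
    (integrableOn_weight_of_pos s ht) (aestronglyMeasurable_weight (s - 1) t).neg ?_
    (integrableOn_weight_of_pos _ (half_pos ht)) ?_
  · have h := key.2
    rw [integral_neg] at h
    exact h
  · filter_upwards [ae_restrict_mem measurableSet_Ioi] with x hx u hu
    rw [norm_neg, Real.norm_of_nonneg (weight_pos _ u hx).le]
    exact weight_le_weight _ hx (le_of_lt hu)
  · filter_upwards [ae_restrict_mem measurableSet_Ioi] with x hx u _
    have h := ((((hasDerivAt_id u).div_const x).const_sub (-x)).exp).const_mul (x ^ s)
    refine h.congr_deriv ?_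
    rw [weight_pred _ _ hx, weight]
    simp only [id]
    ring

theorem moment_zero_succ {s : ℝ} (hs : -1 < s) : moment (s + 1) 0 = (s + 1) * moment s 0 := by
  have h : ∀ r : ℝ, -1 < r → moment r 0 = Real.Gamma (r + 1) := by
    intro r hr
    rw [Real.Gamma_eq_integral (by linarith)]
    simp [moment, weight, mul_comm]
  rw [h s hs, h (s + 1) (by linarith), Real.Gamma_add_one (by linarith)]

/-- Integration by parts for the moments of the perturbed Laguerre weight. -/
theorem moment_succ_of_pos {s t : ℝ} (hs : -1 < s) (ht : 0 < t) :
    moment (s + 1) t - t * moment (s - 1) t = (s + 1) * moment s t := by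
  have hd : ∀ x ∈ Ioi (0 : ℝ), HasDerivAt (weight (s + 1) t)
      ((s + 1) * weight s t x - weight (s + 1) t x + t * weight (s - 1) t x) x := by
    intro x hx
    have hx0 : x ≠ 0 := ne_of_gt hx
    have h := (Real.hasDerivAt_rpow_const (x := x) (p := s + 1) (Or.inl hx0)).mul
      (((hasDerivAt_id x).neg.sub ((hasDerivAt_inv hx0).const_mul t)).exp)
    refine (h.congr_deriv ?_)
    rw [weight_pred _ _ hx, weight_succ _ _ hx]
    simp only [weight, add_sub_cancel_right, Real.rpow_add_one hx0]
    simp only [Pi.neg_apply, Pi.sub_apply, id, div_eq_mul_inv]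
    field_simp
    ring
  have h0 : weight (s + 1) t 0 = 0 := by
    rw [weight, Real.zero_rpow (by linarith), zero_mul]
  have hcont : ContinuousWithinAt (weight (s + 1) t) (Ici 0) 0 := by
    have hb : Tendsto (fun x : ℝ => x ^ (s + 1)) (𝓝[Ici 0] 0) (𝓝 0) := by
      have := (Real.continuousAt_rpow_const 0 (s + 1) (Or.inr (by linarith))).tendsto
      rw [Real.zero_rpow (by linarith)] at this
      exact this.mono_left nhdsWithin_le_nhds
    rw [ContinuousWithinAt, h0]
    refine tendsto_of_tendsto_of_tendsto_of_le_of_le' tendsto_const_nhds hb ?_ ?_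
    · filter_upwards [self_mem_nhdsWithin] with x hx
      exact mul_nonneg (Real.rpow_nonneg hx _) (Real.exp_pos _).le
    · filter_upwards [self_mem_nhdsWithin] with x hx
      have hx' : (0 : ℝ) ≤ x := hx
      refine mul_le_of_le_one_right (Real.rpow_nonneg hx _) (Real.exp_le_one_iff.2 ?_)
      have : 0 ≤ t / x := by positivity
      linarith
  have hinf : Tendsto (weight (s + 1) t) atTop (𝓝 0) := by
    have hb := tendsto_rpow_mul_exp_neg_mul_atTop_nhds_zero (s + 1) 1 one_pos
    refine tendsto_of_tendsto_of_tendsto_of_le_of_le' tendsto_const_nhds hb ?_ ?_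
    · filter_upwards [eventually_gt_atTop 0] with x hx
      exact (weight_pos _ _ hx).le
    · filter_upwards [eventually_gt_atTop 0] with x hx
      have := weight_le_weight (s + 1) hx ht.le
      simpa [weight] using this
  have i1 := (integrableOn_weight_of_pos s ht).const_mul (s + 1)
  have i2 := integrableOn_weight_of_pos (s + 1) ht
  have i3 := (integrableOn_weight_of_pos (s - 1) ht).const_mul t
  have key := integral_Ioi_of_hasDerivAt_of_tendsto hcont hd ((i1.sub i2).add i3) hinf
  have hsplit : ∫ x in Ioi (0 : ℝ),
      ((s + 1) * weight s t x - weight (s + 1) t x + t * weight (s - 1) t x)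
      = (s + 1) * moment s t - moment (s + 1) t + t * moment (s - 1) t := by
    have e1 := integral_add (i1.sub i2) i3
    have e2 := integral_sub i1 i2
    rw [integral_const_mul] at e1 e2
    exact e1.trans (congrArg (· + t * moment (s - 1) t) e2)
  rw [hsplit, h0] at key
  linarith

theorem moment_succ {s t : ℝ} (hs : -1 < s) (ht : 0 ≤ t) :
    moment (s + 1) t - t * moment (s - 1) t = (s + 1) * moment s t := by
  rcases ht.eq_or_lt with rfl | ht
  · rw [zero_mul, sub_zero, moment_zero_succ hs]
  · exact moment_succ_of_pos hs ht

open Polynomial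

/-- Integration of polynomials against the perturbed Laguerre weight, as a linear functional. -/
def momentFunctional (s t : ℝ) : ℝ[X] →ₗ[ℝ] ℝ :=
  Polynomial.lsum fun i => moment (s + i) t • LinearMap.id

theorem momentFunctional_monomial (s t : ℝ) (i : ℕ) (c : ℝ) :
    momentFunctional s t (monomial i c) = moment (s + i) t * c := by
  simp [momentFunctional, Polynomial.lsum]

theorem momentFunctional_eq_sum (s t : ℝ) {p : ℝ[X]} {N : ℕ} (hp : p.natDegree < N) :
    momentFunctional s t p = ∑ i ∈ Finset.range N, moment (s + i) t * p.coeff i := by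
  rw [momentFunctional, Polynomial.lsum_apply, Polynomial.sum_over_range' _ (by simp) N hp]
  simp

theorem momentFunctional_C_mul (s t c : ℝ) (p : ℝ[X]) :
    momentFunctional s t (C c * p) = c * momentFunctional s t p := by
  rw [← smul_eq_C_mul, map_smul, smul_eq_mul]

theorem momentFunctional_X_mul (s t : ℝ) (p : ℝ[X]) :
    momentFunctional s t (X * p) = momentFunctional (s + 1) t p := by
  induction p using Polynomial.induction_on' with
  | add p q hp hq => rw [mul_add, map_add, map_add, hp, hq]
  | monomial i c =>
    rw [X_mul_monomial, momentFunctional_monomial, momentFunctional_monomial]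
    push_cast
    rw [add_comm (i : ℝ) 1, add_assoc]

/-- Integration by parts for the moment functional. -/
theorem momentFunctional_X_mul_derivative {s t : ℝ} (hs : -1 < s) (ht : 0 ≤ t) (p : ℝ[X]) :
    momentFunctional s t (X * derivative p) + (s + 1) * momentFunctional s t p
      = momentFunctional (s + 1) t p - t * momentFunctional (s - 1) t p := by
  induction p using Polynomial.induction_on' with
  | add p q hp hq =>
    simp only [map_add, mul_add]
    linarith
  | monomial i c =>
    have hi : (0 : ℝ) ≤ i := i.cast_nonneg
    have h := moment_succ (s := s + i) (t := t) (by linarith) ht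
    have hX : X * derivative (monomial i c) = monomial i ((i : ℝ) * c) := by
      rw [derivative_monomial]
      rcases i with _ | i
      · simp
      · rw [X_mul_monomial, Nat.add_sub_cancel, mul_comm c]
    rw [hX]
    simp only [momentFunctional_monomial]
    rw [show s + 1 + (i : ℝ) = s + i + 1 by ring, show s - 1 + (i : ℝ) = s + i - 1 by ring]
    linear_combination -c * h

theorem hasIntegral_momentFunctional {s t : ℝ} (hs : -1 < s) (ht : 0 ≤ t) (p : ℝ[X]) :
    IntegrableOn (fun x => p.eval x * weight s t x) (Ioi 0) ∧
      ∫ x in Ioi (0 : ℝ), p.eval x * weight s t x = momentFunctional s t p := by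
  induction p using Polynomial.induction_on' with
  | add p q hp hq =>
    simp only [eval_add, add_mul, map_add]
    exact ⟨hp.1.add hq.1, by rw [integral_add hp.1 hq.1, hp.2, hq.2]⟩
  | monomial i c =>
    have hi : (0 : ℝ) ≤ i := i.cast_nonneg
    have heq : EqOn (fun x => c * weight (s + i) t x)
        (fun x => (monomial i c).eval x * weight s t x) (Ioi 0) := by
      intro x hx
      simp only [weight_add_nat _ _ _ hx, eval_monomial]
      ring
    have hint : IntegrableOn (fun x => c * weight (s + i) t x) (Ioi 0) :=
      (integrableOn_weight (by linarith) ht).const_mul c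
    refine ⟨hint.congr_fun heq measurableSet_Ioi, ?_⟩
    rw [← setIntegral_congr_fun measurableSet_Ioi heq, integral_const_mul,
      momentFunctional_monomial, mul_comm]
    rfl

theorem momentFunctional_mul_self_pos {s t : ℝ} (hs : -1 < s) (ht : 0 ≤ t) {p : ℝ[X]}
    (hp : p ≠ 0) : 0 < momentFunctional s t (p * p) := by
  obtain ⟨hi, he⟩ := hasIntegral_momentFunctional hs ht (p * p)
  rw [← he, setIntegral_pos_iff_support_of_nonneg_ae _ hi]
  · have hsub : Ioi (0 : ℝ) \ (p.rootSet ℝ) ⊆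
        Function.support (fun x => (p * p).eval x * weight s t x) ∩ Ioi 0 := by
      intro x hx
      refine ⟨?_, hx.1⟩
      have h0 : p.eval x ≠ 0 := by
        intro h
        exact hx.2 (by rw [mem_rootSet]; exact ⟨hp, by simpa using h⟩)
      rw [Function.mem_support, eval_mul]
      exact mul_ne_zero (mul_ne_zero h0 h0) (weight_pos s t hx.1).ne'
    refine lt_of_lt_of_le ?_ (measure_mono hsub)
    rw [measure_sdiff_null ((rootSet_finite p ℝ).measure_zero volume)]
    simp
  · filter_upwards [ae_restrict_mem measurableSet_Ioi] with x hx
    rw [eval_mul]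
    exact mul_nonneg (mul_self_nonneg _) (weight_pos s t hx).le

theorem continuousOn_momentFunctional {s : ℝ} (hs : -1 < s) {F : ℝ → ℝ[X]} {N : ℕ}
    (hN : ∀ t, (F t).natDegree ≤ N)
    (hF : ∀ i, ContinuousOn (fun t => (F t).coeff i) (Ici 0)) :
    ContinuousOn (fun t => momentFunctional s t (F t)) (Ici 0) := by
  have h : (fun t => momentFunctional s t (F t)) =
      fun t => ∑ i ∈ Finset.range (N + 1), moment (s + i) t * (F t).coeff i :=
    funext fun t => momentFunctional_eq_sum s t (Nat.lt_succ_of_le (hN t))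
  rw [h]
  refine continuousOn_finsetSum _ fun i _ => (continuousOn_moment ?_).mul (hF i)
  have hi : (0 : ℝ) ≤ i := i.cast_nonneg
  linarith

/-- Differentiation of the moment functional in the deformation parameter only. -/
theorem hasDerivAt_momentFunctional_sub {s t : ℝ} (ht : 0 < t) {F : ℝ → ℝ[X]} {N : ℕ}
    (hN : ∀ u, (F u).natDegree ≤ N) (hF : ∀ i, ContinuousAt (fun u => (F u).coeff i) t) :
    HasDerivAt (fun u => momentFunctional s u (F u) - momentFunctional s t (F u))
      (-momentFunctional (s - 1) t (F t)) t := by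
  have h : (fun u => momentFunctional s u (F u) - momentFunctional s t (F u)) =
      fun u => ∑ i ∈ Finset.range (N + 1),
        (moment (s + i) u - moment (s + i) t) * (F u).coeff i := by
    funext u
    rw [momentFunctional_eq_sum s u (Nat.lt_succ_of_le (hN u)),
      momentFunctional_eq_sum s t (Nat.lt_succ_of_le (hN u)), ← Finset.sum_sub_distrib]
    simp only [sub_mul]
  rw [h, momentFunctional_eq_sum (s - 1) t (Nat.lt_succ_of_le (hN t)), ← Finset.sum_neg_distrib]
  refine HasDerivAt.fun_sum fun i _ => ?_
  have hm := hasDerivAt_moment (s + i) ht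
  rw [hasDerivAt_iff_tendsto_slope] at hm ⊢
  have hc := (hF i).tendsto.mono_left (nhdsWithin_le_nhds (s := {t}ᶜ))
  have := hm.mul hc
  rw [show s + (i : ℝ) - 1 = s - 1 + i by ring, neg_mul] at this
  refine this.congr fun u => ?_
  simp only [slope_def_field, sub_self, zero_mul, sub_zero]
  ring

/-- `p` is the monic orthogonal system, with squared norms `h`, for the perturbed Laguerre
weight. -/
structure IsMonicOrthogonal (s t : ℝ) (p : ℕ → ℝ[X]) (h : ℕ → ℝ) : Prop where
  monic : ∀ m, (p m).Monic
  natDegree_eq : ∀ m, (p m).natDegree = m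
  orth : ∀ j k, momentFunctional s t (p j * p k) = if j = k then h j else 0
  pos : ∀ j, 0 < h j

theorem degree_sub_C_mul_lt {p R : ℝ[X]} {m : ℕ} (hp : p.Monic) (hd : p.natDegree = m)
    (hR : R.degree < (m + 1 : ℕ)) : (R - C (R.coeff m) * p).degree < m := by
  rw [degree_lt_iff_coeff_zero] at hR ⊢
  intro k hk
  rw [coeff_sub, coeff_C_mul]
  rcases hk.eq_or_lt with rfl | hk
  · have : p.coeff m = 1 := by simpa [hd] using hp.coeff_natDegree
    rw [this, mul_one, sub_self]
  · rw [hR k hk, coeff_eq_zero_of_natDegree_lt (p := p) (by rwa [hd]), mul_zero,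
      sub_zero]

namespace IsMonicOrthogonal

variable {s t : ℝ} {p : ℕ → ℝ[X]} {h : ℕ → ℝ}

theorem coeff_self (H : IsMonicOrthogonal s t p h) (m : ℕ) : (p m).coeff m = 1 := by
  simpa [H.natDegree_eq m] using (H.monic m).coeff_natDegree

theorem coeff_of_lt (H : IsMonicOrthogonal s t p h) {m k : ℕ} (hk : m < k) :
    (p m).coeff k = 0 :=
  coeff_eq_zero_of_natDegree_lt (by rwa [H.natDegree_eq])

theorem momentFunctional_mul_of_degree_lt (H : IsMonicOrthogonal s t p h) {n : ℕ} {R : ℝ[X]}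
    (hR : R.degree < n) : momentFunctional s t (p n * R) = 0 := by
  suffices ∀ m ≤ n, ∀ R : ℝ[X], R.degree < m → momentFunctional s t (p n * R) = 0 from
    this n le_rfl R hR
  intro m
  induction m with
  | zero =>
    intro _ R hR
    have : R = 0 := by simpa [Nat.WithBot.lt_zero_iff] using hR
    simp [this]
  | succ m ih =>
    intro hm R hR
    have h1 := ih (by omega) _ (degree_sub_C_mul_lt (H.monic m) (H.natDegree_eq m) hR)
    rw [mul_sub, map_sub, mul_left_comm, momentFunctional_C_mul, H.orth n m,
      if_neg (by omega), mul_zero, sub_zero] at h1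
    exact h1

theorem momentFunctional_mul (H : IsMonicOrthogonal s t p h) {n : ℕ} {R : ℝ[X]}
    (hR : R.natDegree ≤ n) : momentFunctional s t (p n * R) = R.coeff n * h n := by
  have hR' : R.degree < (n + 1 : ℕ) :=
    (degree_le_of_natDegree_le hR).trans_lt (by exact_mod_cast n.lt_succ_self)
  have h1 := H.momentFunctional_mul_of_degree_lt
    (degree_sub_C_mul_lt (H.monic n) (H.natDegree_eq n) hR')
  rw [mul_sub, map_sub, mul_left_comm, momentFunctional_C_mul, H.orth n n, if_pos rfl,
    sub_eq_zero] at h1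
  exact h1

theorem momentFunctional_pred_mul (H : IsMonicOrthogonal s t p h) {n : ℕ} {R : ℝ[X]}
    (hR : R.natDegree ≤ n + 1) :
    momentFunctional (s - 1) t (p n * R)
      = R.coeff 0 * momentFunctional (s - 1) t (p n) + R.coeff (n + 1) * h n := by
  have h1 : p n * R = X * (p n * R.divX) + C (R.coeff 0) * p n := by
    conv_lhs => rw [← R.divX_mul_X_add]
    ring
  have h2 : R.divX.natDegree ≤ n := by rw [natDegree_divX_eq_natDegree_tsub_one]; omega
  rw [h1, map_add, momentFunctional_X_mul, momentFunctional_C_mul, sub_add_cancel,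
    H.momentFunctional_mul h2, coeff_divX, add_comm]

theorem momentFunctional_pred_pred_mul (H : IsMonicOrthogonal s t p h) {n : ℕ} {R : ℝ[X]}
    (hR : R.natDegree ≤ n + 2) :
    momentFunctional (s - 2) t (p n * R)
      = R.coeff 0 * momentFunctional (s - 2) t (p n)
        + R.coeff 1 * momentFunctional (s - 1) t (p n) + R.coeff (n + 2) * h n := by
  have h1 : p n * R = X * (p n * R.divX) + C (R.coeff 0) * p n := by
    conv_lhs => rw [← R.divX_mul_X_add]
    ring
  have h2 : R.divX.natDegree ≤ n + 1 := by rw [natDegree_divX_eq_natDegree_tsub_one]; omega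
  rw [h1, map_add, momentFunctional_X_mul, momentFunctional_C_mul,
    show s - 2 + 1 = s - 1 by ring, H.momentFunctional_pred_mul h2, coeff_divX, coeff_divX]
  ring

theorem momentFunctional_mul_derivative_self (H : IsMonicOrthogonal s t p h) (n : ℕ) :
    momentFunctional s t (p n * derivative (p n)) = 0 := by
  have hd := H.natDegree_eq n
  rw [H.momentFunctional_mul ((natDegree_derivative_le _).trans (by omega)), coeff_derivative,
    H.coeff_of_lt n.lt_succ_self, zero_mul, zero_mul]

theorem inverse_moment_self (H : IsMonicOrthogonal s t p h) (hs : 0 < s) (ht : 0 ≤ t) (n : ℕ) :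
    s * momentFunctional (s - 1) t (p n * p n) + t * momentFunctional (s - 2) t (p n * p n)
      = h n := by
  have h1 := momentFunctional_X_mul_derivative (s := s - 1) (by linarith) ht (p n * p n)
  rw [momentFunctional_X_mul, sub_add_cancel, derivative_mul, map_add,
    mul_comm (derivative _), H.momentFunctional_mul_derivative_self, H.orth, if_pos rfl,
    show s - 1 - 1 = s - 2 by ring] at h1
  linarith

theorem inverse_moment_succ (H : IsMonicOrthogonal s t p h) (hs : 0 < s) (ht : 0 ≤ t) (k : ℕ) :
    s * momentFunctional (s - 1) t (p (k + 1) * p k)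
      + t * momentFunctional (s - 2) t (p (k + 1) * p k) = -((k + 1) * h k) := by
  have h1 := momentFunctional_X_mul_derivative (s := s - 1) (by linarith) ht (p (k + 1) * p k)
  have hd := H.natDegree_eq k
  have hd' := H.natDegree_eq (k + 1)
  rw [momentFunctional_X_mul, sub_add_cancel, derivative_mul, map_add,
    mul_comm (derivative _),
    H.momentFunctional_mul (n := k) ((natDegree_derivative_le _).trans (by omega)),
    H.momentFunctional_mul (n := k + 1) ((natDegree_derivative_le _).trans (by omega)),
    H.orth, if_neg (by omega), coeff_derivative, coeff_derivative, H.coeff_self,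
    H.coeff_of_lt (by omega), show s - 1 - 1 = s - 2 by ring] at h1
  linarith

/-- The first ladder relation: the diagonal recurrence coefficient in terms of the inverse
moment. -/
theorem diagonal_coeff (H : IsMonicOrthogonal s t p h) (hs : 0 < s) (ht : 0 ≤ t) (n : ℕ) :
    momentFunctional s t (X * (p n * p n))
      = (2 * n + 1 + s) * h n + t * momentFunctional (s - 1) t (p n * p n) := by
  have h1 := momentFunctional_X_mul_derivative (s := s) (by linarith) ht (p n * p n)
  have hd := H.natDegree_eq n
  have hX : X * derivative (p n * p n) = p n * (C 2 * (X * derivative (p n))) := by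
    rw [derivative_mul, C_ofNat]
    ring
  have hc : (C 2 * (X * derivative (p n))).coeff n = (2 * n : ℝ) := by
    rw [coeff_C_mul]
    rcases n with _ | m
    · simp
    · rw [coeff_X_mul, coeff_derivative, H.coeff_self]
      push_cast
      ring
  have hdeg : (C 2 * (X * derivative (p n))).natDegree ≤ n := by
    rw [natDegree_le_iff_coeff_eq_zero]
    intro N hN
    obtain ⟨N, rfl⟩ : ∃ M, N = M + 1 := ⟨N - 1, by omega⟩
    rw [coeff_C_mul, coeff_X_mul, coeff_derivative, H.coeff_of_lt hN, zero_mul, mul_zero]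
  rw [hX, H.momentFunctional_mul hdeg, hc, H.orth, if_pos rfl, ← momentFunctional_X_mul] at h1
  linarith

theorem norm_ratio (H : IsMonicOrthogonal s t p h) (hs : 0 < s) (ht : 0 ≤ t) (k : ℕ) :
    h (k + 1) + (p (k + 1)).coeff k * h k
      = t * momentFunctional (s - 1) t (p (k + 1) * p k) := by
  have h1 := momentFunctional_X_mul_derivative (s := s) (by linarith) ht (p (k + 1) * p k)
  have hdeg : (X * p k).natDegree ≤ k + 1 := by
    refine natDegree_mul_le.trans ?_
    rw [natDegree_X, H.natDegree_eq, add_comm]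
  have hXd : ∀ m, (X * derivative (p m)).natDegree ≤ m := by
    intro m
    rw [natDegree_le_iff_coeff_eq_zero]
    intro N hN
    obtain ⟨N, rfl⟩ : ∃ M, N = M + 1 := ⟨N - 1, by omega⟩
    rw [coeff_X_mul, coeff_derivative, H.coeff_of_lt hN, zero_mul]
  have hR : (X * derivative (p (k + 1)) - C (k + 1 : ℝ) * p (k + 1)).natDegree ≤ k := by
    rw [natDegree_le_iff_coeff_eq_zero]
    intro N hN
    obtain ⟨N, rfl⟩ : ∃ M, N = M + 1 := ⟨N - 1, by omega⟩
    rw [coeff_sub, coeff_X_mul, coeff_derivative, coeff_C_mul]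
    rcases (Nat.lt_succ_iff.1 hN).eq_or_lt with rfl | hN'
    · ring
    · rw [H.coeff_of_lt (by omega)]
      ring
  have hRc : (X * derivative (p (k + 1)) - C (k + 1 : ℝ) * p (k + 1)).coeff k
      = -(p (k + 1)).coeff k := by
    rw [coeff_sub, coeff_C_mul]
    rcases k with _ | m
    · simp
    · rw [coeff_X_mul, coeff_derivative]
      push_cast
      ring
  have hX : X * derivative (p (k + 1) * p k)
      = p k * (X * derivative (p (k + 1)) - C (k + 1 : ℝ) * p (k + 1))
        + C (k + 1 : ℝ) * (p (k + 1) * p k) + p (k + 1) * (X * derivative (p k)) := by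
    rw [derivative_mul]
    ring
  rw [hX, map_add, map_add, momentFunctional_C_mul, H.momentFunctional_mul hR, hRc,
    H.momentFunctional_mul ((hXd k).trans k.le_succ),
    coeff_eq_zero_of_natDegree_lt (Nat.lt_succ_of_le (hXd k)), H.orth, if_neg (by omega),
    ← momentFunctional_X_mul, mul_left_comm, H.momentFunctional_mul hdeg, coeff_X_mul,
    H.coeff_self] at h1
  linarith

theorem product_relation (H : IsMonicOrthogonal s t p h) (k : ℕ) :
    momentFunctional (s - 1) t (p (k + 1) * p k)
        * (momentFunctional (s - 1) t (p (k + 1) * p k) - h k)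
      = momentFunctional (s - 1) t (p (k + 1) * p (k + 1))
        * momentFunctional (s - 1) t (p k * p k) := by
  have hd := H.natDegree_eq k
  have hd' := H.natDegree_eq (k + 1)
  have e1 := H.momentFunctional_pred_mul (n := k + 1) (R := p k) (by omega)
  have e2 := H.momentFunctional_pred_mul (n := k) (R := p (k + 1)) (by omega)
  have e3 := H.momentFunctional_pred_mul (n := k + 1) (R := p (k + 1)) (by omega)
  have e4 := H.momentFunctional_pred_mul (n := k) (R := p k) (by omega)
  rw [mul_comm (p k), H.coeff_self] at e2
  rw [H.coeff_of_lt (m := k) (k := k + 1 + 1) (by omega)] at e1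
  rw [H.coeff_of_lt (m := k + 1) (k := k + 1 + 1) (by omega)] at e3
  rw [H.coeff_of_lt (m := k) (k := k + 1) (by omega)] at e4
  rw [e3, e4]
  nth_rw 1 [e1]
  rw [e2]
  ring

theorem second_order_relation (H : IsMonicOrthogonal s t p h) (k : ℕ) :
    momentFunctional (s - 1) t (p k * p k) * momentFunctional (s - 2) t (p (k + 1) * p (k + 1))
      + momentFunctional (s - 1) t (p (k + 1) * p (k + 1)) * momentFunctional (s - 2) t (p k * p k)
      = momentFunctional (s - 2) t (p (k + 1) * p k)
        * (2 * momentFunctional (s - 1) t (p (k + 1) * p k) - h k) := by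
  have hd := H.natDegree_eq k
  have hd' := H.natDegree_eq (k + 1)
  have e1 := H.momentFunctional_pred_mul (n := k + 1) (R := p k) (by omega)
  have e2 := H.momentFunctional_pred_mul (n := k) (R := p (k + 1)) (by omega)
  have e3 := H.momentFunctional_pred_pred_mul (n := k + 1) (R := p k) (by omega)
  have e4 := H.momentFunctional_pred_pred_mul (n := k) (R := p (k + 1)) (by omega)
  have f1 := H.momentFunctional_pred_mul (n := k + 1) (R := p (k + 1)) (by omega)
  have f2 := H.momentFunctional_pred_mul (n := k) (R := p k) (by omega)
  have f3 := H.momentFunctional_pred_pred_mul (n := k + 1) (R := p (k + 1)) (by omega)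
  have f4 := H.momentFunctional_pred_pred_mul (n := k) (R := p k) (by omega)
  rw [mul_comm (p k), H.coeff_self] at e2
  rw [mul_comm (p k)] at e4
  rw [H.coeff_of_lt (m := k) (k := k + 1 + 1) (by omega)] at e1
  rw [H.coeff_of_lt (m := k + 1) (k := k + 1 + 1) (by omega)] at f1
  rw [H.coeff_of_lt (m := k) (k := k + 1) (by omega)] at f2
  rw [H.coeff_of_lt (m := k) (k := k + 1 + 2) (by omega)] at e3
  rw [H.coeff_of_lt (m := k + 1) (k := k + 2) (by omega)] at e4
  rw [H.coeff_of_lt (m := k + 1) (k := k + 1 + 2) (by omega)] at f3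
  rw [H.coeff_of_lt (m := k) (k := k + 2) (by omega)] at f4
  rw [f1, f2, f3, f4]
  linear_combination
    -((p k).coeff 0 * momentFunctional (s - 1) t (p (k + 1))) * e4
      - (p (k + 1)).coeff 0 * momentFunctional (s - 1) t (p k) * e3
      - momentFunctional (s - 2) t (p (k + 1) * p k) * (e1 + e2)

/-- The linear relation coupling consecutive inverse moments. -/
theorem sum_relation (H : IsMonicOrthogonal s t p h) (hs : 0 < s) (ht : 0 ≤ t) (k : ℕ) :
    h (k + 1) * momentFunctional (s - 1) t (p k * p k)
        + h k * momentFunctional (s - 1) t (p (k + 1) * p (k + 1))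
      = (k + 1) * h k ^ 2
        - (2 * (k + 1) + s) * (h k * momentFunctional (s - 1) t (p (k + 1) * p k)) := by
  linear_combination t * H.second_order_relation k
    - momentFunctional (s - 1) t (p k * p k) * H.inverse_moment_self hs ht (k + 1)
    - momentFunctional (s - 1) t (p (k + 1) * p (k + 1)) * H.inverse_moment_self hs ht k
    + (2 * momentFunctional (s - 1) t (p (k + 1) * p k) - h k) * H.inverse_moment_succ hs ht k
    - 2 * s * H.product_relation k

end IsMonicOrthogonal

/-- The monic orthogonal polynomials of the perturbed Laguerre weight, built from their three-term
recurrence; the definition also covers the unperturbed case `t = 0`. -/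
def orthoPoly (s t : ℝ) : ℕ → ℝ[X]
  | 0 => 1
  | 1 => X - C (momentFunctional s t X / momentFunctional s t 1)
  | m + 2 =>
    (X - C (momentFunctional s t (X * (orthoPoly s t (m + 1) * orthoPoly s t (m + 1)))
        / momentFunctional s t (orthoPoly s t (m + 1) * orthoPoly s t (m + 1))))
      * orthoPoly s t (m + 1)
    - C (momentFunctional s t (X * (orthoPoly s t (m + 1) * orthoPoly s t m))
        / momentFunctional s t (orthoPoly s t m * orthoPoly s t m)) * orthoPoly s t m

theorem orthoPoly_monic_natDegree (s t : ℝ) (m : ℕ) :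
    (orthoPoly s t m).Monic ∧ (orthoPoly s t m).natDegree = m := by
  induction m using Nat.twoStepInduction with
  | zero => simp [orthoPoly]
  | one => exact ⟨monic_X_sub_C _, natDegree_X_sub_C _⟩
  | more m ih0 ih1 =>
    rw [orthoPoly]
    generalize momentFunctional s t (X * (orthoPoly s t (m + 1) * orthoPoly s t (m + 1)))
        / momentFunctional s t (orthoPoly s t (m + 1) * orthoPoly s t (m + 1)) = a
    generalize momentFunctional s t (X * (orthoPoly s t (m + 1) * orthoPoly s t m))
        / momentFunctional s t (orthoPoly s t m * orthoPoly s t m) = b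
    have hM : ((X - C a) * orthoPoly s t (m + 1)).Monic := (monic_X_sub_C a).mul ih1.1
    have hD : ((X - C a) * orthoPoly s t (m + 1)).natDegree = m + 2 := by
      rw [(monic_X_sub_C a).natDegree_mul ih1.1, natDegree_X_sub_C, ih1.2]
      ring
    have hlt : (C b * orthoPoly s t m).natDegree
        < ((X - C a) * orthoPoly s t (m + 1)).natDegree := by
      have := natDegree_C_mul_le b (orthoPoly s t m)
      omega
    exact ⟨hM.sub_of_left (degree_lt_degree hlt),
      (natDegree_sub_eq_left_of_natDegree_lt hlt).trans hD⟩

theorem natDegree_orthoPoly (s t : ℝ) (m : ℕ) : (orthoPoly s t m).natDegree = m :=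
  (orthoPoly_monic_natDegree s t m).2

theorem momentFunctional_orthoPoly_mul_self_pos {s t : ℝ} (hs : -1 < s) (ht : 0 ≤ t) (m : ℕ) :
    0 < momentFunctional s t (orthoPoly s t m * orthoPoly s t m) :=
  momentFunctional_mul_self_pos hs ht (orthoPoly_monic_natDegree s t m).1.ne_zero

theorem continuousOn_coeff_mul {S : Set ℝ} {F G : ℝ → ℝ[X]}
    (hF : ∀ i, ContinuousOn (fun t => (F t).coeff i) S)
    (hG : ∀ i, ContinuousOn (fun t => (G t).coeff i) S) (i : ℕ) :
    ContinuousOn (fun t => (F t * G t).coeff i) S := by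
  simp only [coeff_mul]
  exact continuousOn_finsetSum _ fun x _ => (hF x.1).mul (hG x.2)

theorem continuousOn_coeff_orthoPoly {s : ℝ} (hs : -1 < s) (m : ℕ) :
    ∀ i, ContinuousOn (fun t => (orthoPoly s t m).coeff i) (Ici 0) := by
  have hX : ∀ i, ContinuousOn (fun _ : ℝ => (X : ℝ[X]).coeff i) (Ici 0) :=
    fun i => continuousOn_const
  induction m using Nat.twoStepInduction with
  | zero => exact fun i => continuousOn_const
  | one =>
    intro i
    have h1 : ∀ t, 0 ≤ t → 0 < momentFunctional s t 1 := fun t ht => by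
      simpa [orthoPoly] using momentFunctional_orthoPoly_mul_self_pos hs ht 0
    simp only [orthoPoly, coeff_sub, coeff_C]
    refine continuousOn_const.sub ?_
    split_ifs
    · exact (continuousOn_momentFunctional hs (fun _ => le_rfl) hX).div
        (continuousOn_momentFunctional hs (fun _ => le_rfl) fun i => continuousOn_const)
        fun t ht => (h1 t ht).ne'
    · exact continuousOn_const
  | more m ih0 ih1 =>
    have hdeg : ∀ j k t, (orthoPoly s t j * orthoPoly s t k).natDegree ≤ j + k := by
      intro j k t
      simpa [natDegree_orthoPoly] using
        natDegree_mul_le (p := orthoPoly s t j) (q := orthoPoly s t k)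
    have hdegX : ∀ j k t, (X * (orthoPoly s t j * orthoPoly s t k)).natDegree ≤ 1 + (j + k) := by
      intro j k t
      refine natDegree_mul_le.trans ?_
      rw [natDegree_X]
      exact Nat.add_le_add_left (hdeg j k t) 1
    have c00 := continuousOn_coeff_mul ih0 ih0
    have c10 := continuousOn_coeff_mul ih1 ih0
    have c11 := continuousOn_coeff_mul ih1 ih1
    have ha := (continuousOn_momentFunctional hs (hdegX _ _) (continuousOn_coeff_mul hX c11)).div
      (continuousOn_momentFunctional hs (hdeg _ _) c11)
      fun t ht => (momentFunctional_orthoPoly_mul_self_pos hs ht (m + 1)).ne'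
    have hb := (continuousOn_momentFunctional hs (hdegX _ _) (continuousOn_coeff_mul hX c10)).div
      (continuousOn_momentFunctional hs (hdeg _ _) c00)
      fun t ht => (momentFunctional_orthoPoly_mul_self_pos hs ht m).ne'
    intro i
    simp only [orthoPoly, sub_mul, coeff_sub, coeff_C_mul]
    exact ((continuousOn_coeff_mul hX ih1 i).sub (ha.mul (ih1 i))).sub (hb.mul (ih0 i))

namespace IsMonicOrthogonal

variable {s t : ℝ} {p : ℕ → ℝ[X]} {h A B : ℕ → ℝ}

theorem diag_mul_norm (H : IsMonicOrthogonal s t p h) {m : ℕ}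
    (hrec : X * p (m + 1) = p (m + 2) + C (A (m + 1)) * p (m + 1) + C (B (m + 1)) * p m) :
    A (m + 1) * h (m + 1) = momentFunctional s t (X * (p (m + 1) * p (m + 1))) := by
  rw [← mul_assoc, hrec, add_mul, add_mul, map_add, map_add, mul_assoc, mul_assoc,
    momentFunctional_C_mul, momentFunctional_C_mul, H.orth, H.orth, H.orth, if_neg (by omega),
    if_pos rfl, if_neg (by omega)]
  ring

theorem offDiag_mul_norm (H : IsMonicOrthogonal s t p h) {m : ℕ}
    (hrec : X * p (m + 1) = p (m + 2) + C (A (m + 1)) * p (m + 1) + C (B (m + 1)) * p m) :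
    B (m + 1) * h m = momentFunctional s t (X * (p (m + 1) * p m)) := by
  rw [← mul_assoc, hrec, add_mul, add_mul, map_add, map_add, mul_assoc, mul_assoc,
    momentFunctional_C_mul, momentFunctional_C_mul, H.orth, H.orth, H.orth, if_neg (by omega),
    if_neg (by omega), if_pos rfl]
  ring

theorem offDiag_mul_norm_eq (H : IsMonicOrthogonal s t p h) {m : ℕ}
    (hrec : X * p (m + 1) = p (m + 2) + C (A (m + 1)) * p (m + 1) + C (B (m + 1)) * p m) :
    B (m + 1) * h m = h (m + 1) := by
  have hdeg : (X * p m).natDegree ≤ m + 1 := by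
    refine natDegree_mul_le.trans ?_
    rw [natDegree_X, H.natDegree_eq, add_comm]
  rw [H.offDiag_mul_norm hrec, mul_left_comm, H.momentFunctional_mul hdeg, coeff_X_mul,
    H.coeff_self, one_mul]

theorem diag_eq_coeff_sub (H : IsMonicOrthogonal s t p h) {m : ℕ}
    (hrec : X * p (m + 1) = p (m + 2) + C (A (m + 1)) * p (m + 1) + C (B (m + 1)) * p m) :
    A (m + 1) = (p (m + 1)).coeff m - (p (m + 2)).coeff (m + 1) := by
  have h1 := congrArg (fun q => q.coeff (m + 1)) hrec
  simp only [coeff_add, coeff_C_mul, coeff_X_mul, H.coeff_self,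
    H.coeff_of_lt (m := m) (k := m + 1) (by omega)] at h1
  linarith

/-- The contiguous relation between consecutive mixed inverse moments. -/
theorem mixed_inverse_moment_succ (H : IsMonicOrthogonal s t p h) {m : ℕ}
    (hrec : X * p (m + 1) = p (m + 2) + C (A (m + 1)) * p (m + 1) + C (B (m + 1)) * p m) :
    momentFunctional (s - 1) t (p (m + 2) * p (m + 1))
      = h (m + 1) - A (m + 1) * momentFunctional (s - 1) t (p (m + 1) * p (m + 1))
        - B (m + 1) * momentFunctional (s - 1) t (p (m + 1) * p m) := by
  have h1 : X * (p (m + 1) * p (m + 1)) = p (m + 2) * p (m + 1)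
      + C (A (m + 1)) * (p (m + 1) * p (m + 1)) + C (B (m + 1)) * (p (m + 1) * p m) := by
    rw [← mul_assoc, hrec]
    ring
  have h2 := congrArg (momentFunctional (s - 1) t) h1
  rw [momentFunctional_X_mul, map_add, map_add, momentFunctional_C_mul, momentFunctional_C_mul,
    sub_add_cancel, H.orth, if_pos rfl] at h2
  linarith

theorem eq_orthoPoly (H : IsMonicOrthogonal s t p h)
    (hrec : ∀ m, X * p (m + 1)
      = p (m + 2) + C (A (m + 1)) * p (m + 1) + C (B (m + 1)) * p m) (m : ℕ) :
    p m = orthoPoly s t m := by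
  have h0 : p 0 = 1 := (H.monic 0).natDegree_eq_zero.1 (H.natDegree_eq 0)
  induction m using Nat.twoStepInduction with
  | zero => exact h0
  | one =>
    have h1 : p 1 = X + C ((p 1).coeff 0) := by
      conv_lhs => rw [(p 1).eq_X_add_C_of_natDegree_le_one (H.natDegree_eq 1).le]
      rw [H.coeff_self 1, map_one, one_mul]
    have h2 := H.orth 1 0
    have h3 := H.orth 0 0
    have h4 := H.pos 0
    rw [h0, mul_one] at h2 h3
    rw [if_pos rfl] at h3
    rw [if_neg one_ne_zero, h1, map_add, ← mul_one (C _), momentFunctional_C_mul, h3] at h2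
    rw [h1, orthoPoly, h3, sub_eq_add_neg, ← C_neg]
    congr 2
    field_simp
    linarith
  | more m ih0 ih1 =>
    have hA := H.diag_mul_norm (hrec m)
    have hB := H.offDiag_mul_norm (hrec m)
    have n1 := H.orth (m + 1) (m + 1)
    have n0 := H.orth m m
    rw [if_pos rfl] at n1 n0
    rw [ih1] at hA n1
    rw [ih1, ih0] at hB
    rw [ih0] at n0
    rw [orthoPoly, n0, n1, ← hA, ← hB, mul_div_cancel_right₀ _ (H.pos _).ne',
      mul_div_cancel_right₀ _ (H.pos _).ne', sub_mul, ← ih1, ← ih0, hrec m]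
    ring

end IsMonicOrthogonal

section Deformation

variable {s : ℝ} {h : ℕ → ℝ → ℝ}

theorem continuousAt_coeff_orthoPoly_mul (hs : -1 < s) {t : ℝ} (ht : 0 < t) (m : ℕ) (R : ℝ[X])
    (i : ℕ) : ContinuousAt (fun u => (orthoPoly s u m * R).coeff i) t :=
  (continuousOn_coeff_mul (continuousOn_coeff_orthoPoly hs m) (fun _ => continuousOn_const)
    i).continuousAt (Ici_mem_nhds ht)

theorem natDegree_orthoPoly_mul_le (u : ℝ) (m : ℕ) (R : ℝ[X]) :
    (orthoPoly s u m * R).natDegree ≤ m + R.natDegree := by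
  simpa [natDegree_orthoPoly] using natDegree_mul_le (p := orthoPoly s u m) (q := R)

theorem hasDerivAt_norm (hs : -1 < s)
    (H : ∀ t > 0, IsMonicOrthogonal s t (orthoPoly s t) (h · t)) {t : ℝ} (ht : 0 < t) (m : ℕ) :
    HasDerivAt (h m) (-momentFunctional (s - 1) t (orthoPoly s t m * orthoPoly s t m)) t := by
  have key := (hasDerivAt_momentFunctional_sub (s := s) ht
    (fun u => natDegree_orthoPoly_mul_le u m (orthoPoly s t m))
    (continuousAt_coeff_orthoPoly_mul hs ht m (orthoPoly s t m))).add_const (h m t)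
  refine key.congr_of_eventuallyEq ?_
  filter_upwards [Ioi_mem_nhds ht] with u hu
  have e1 := (H u hu).momentFunctional_mul (natDegree_orthoPoly s t m).le
  have e2 := (H t ht).momentFunctional_mul (natDegree_orthoPoly s u m).le
  rw [(H t ht).coeff_self] at e1
  rw [(H u hu).coeff_self, mul_comm] at e2
  rw [e1, e2]
  ring

theorem hasDerivAt_coeff (hs : -1 < s)
    (H : ∀ t > 0, IsMonicOrthogonal s t (orthoPoly s t) (h · t)) {t : ℝ} (ht : 0 < t) (k : ℕ) :
    HasDerivAt (fun u => (orthoPoly s u (k + 1)).coeff k)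
      (momentFunctional (s - 1) t (orthoPoly s t (k + 1) * orthoPoly s t k) / h k t) t := by
  have key := (((hasDerivAt_momentFunctional_sub (s := s) ht
    (fun u => natDegree_orthoPoly_mul_le u (k + 1) (orthoPoly s t k))
    (continuousAt_coeff_orthoPoly_mul hs ht (k + 1) (orthoPoly s t k))).div_const
      (h k t)).const_sub ((orthoPoly s t (k + 1)).coeff k))
  rw [neg_div, neg_neg] at key
  refine key.congr_of_eventuallyEq ?_
  filter_upwards [Ioi_mem_nhds ht] with u hu
  have hpos := (H t ht).pos k
  have e1 := (H u hu).momentFunctional_mul (n := k + 1) (R := orthoPoly s t k)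
    ((natDegree_orthoPoly s t k).le.trans k.le_succ)
  rw [(H t ht).coeff_of_lt k.lt_succ_self, zero_mul] at e1
  have hdeg : (orthoPoly s u (k + 1) - orthoPoly s t (k + 1)).natDegree ≤ k := by
    rw [natDegree_le_iff_coeff_eq_zero]
    intro N hN
    rw [coeff_sub]
    rcases (Nat.succ_le_of_lt hN).eq_or_lt with rfl | hN
    · rw [Nat.succ_eq_add_one, (H u hu).coeff_self, (H t ht).coeff_self, sub_self]
    · rw [(H u hu).coeff_of_lt hN, (H t ht).coeff_of_lt hN, sub_self]
  have e2 := (H t ht).momentFunctional_mul hdeg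
  rw [mul_sub, map_sub, (H t ht).orth, if_neg (by omega), sub_zero, mul_comm, coeff_sub] at e2
  rw [e1, e2]
  field_simp
  ring

end Deformation

/-- Eliminating `b` from a pair of Riccati equations yields the Painlevé III equation. -/
theorem painleve_of_riccati {s n : ℝ} {a b : ℝ → ℝ}
    (ha : ∀ t > 0, HasDerivAt a ((2 * b t - t + (2 * n + 1 + s + a t) * a t) / t) t)
    (hb : ∀ t > 0, HasDerivAt b
      ((b t + 2 * (b t ^ 2 - t * b t) / a t - n * t + (2 * n + s) * b t) / t) t)
    (ha0 : ∀ t > 0, a t ≠ 0) :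
    ContDiffOn ℝ 2 a (Ioi 0) ∧
      ∀ t > 0, deriv (deriv a) t = deriv a t ^ 2 / a t - deriv a t / t
        + (2 * n + 1 + s) * a t ^ 2 / t ^ 2 + a t ^ 3 / t ^ 2 + s / t - 1 / a t := by
  have hdiff : DifferentiableOn ℝ a (Ioi 0) :=
    fun t ht => (ha t ht).differentiableAt.differentiableWithinAt
  have hbdiff : DifferentiableOn ℝ b (Ioi 0) :=
    fun t ht => (hb t ht).differentiableAt.differentiableWithinAt
  have hC1 : ∀ {f g : ℝ → ℝ}, (∀ t > 0, HasDerivAt f (g t) t) → ∀ m : ℕ,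
      ContDiffOn ℝ m g (Ioi 0) → ContDiffOn ℝ (m + 1) f (Ioi 0) := by
    intro f g hf m hg
    rw [contDiffOn_succ_iff_deriv_of_isOpen isOpen_Ioi]
    exact ⟨fun t ht => (hf t ht).differentiableAt.differentiableWithinAt, by simp,
      hg.congr fun t ht => (hf t ht).deriv⟩
  have ht0 : ∀ t ∈ Ioi (0 : ℝ), t ≠ 0 := fun t ht => ne_of_gt ht
  have hac := hdiff.continuousOn
  have hbc := hbdiff.continuousOn
  have ha1 : ContDiffOn ℝ 1 a (Ioi 0) := by
    refine hC1 ha 0 (contDiffOn_zero.2 ?_)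
    exact ContinuousOn.div (by fun_prop) continuousOn_id ht0
  have hb1 : ContDiffOn ℝ 1 b (Ioi 0) := by
    refine hC1 hb 0 (contDiffOn_zero.2 ?_)
    refine ContinuousOn.div ?_ continuousOn_id ht0
    have : ContinuousOn (fun t => 2 * (b t ^ 2 - t * b t) / a t) (Ioi 0) :=
      ContinuousOn.div (by fun_prop) hac ha0
    fun_prop
  have ha2 : ContDiffOn ℝ 2 a (Ioi 0) := by
    refine hC1 ha 1 ?_
    exact ContDiffOn.div (by fun_prop) contDiffOn_id ht0
  refine ⟨ha2, fun t ht => ?_⟩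
  have hd : deriv a =ᶠ[𝓝 t] fun u => (2 * b u - u + (2 * n + 1 + s + a u) * a u) / u := by
    filter_upwards [Ioi_mem_nhds ht] with u hu using (ha u hu).deriv
  have hat := ha t ht
  have h2 := ((((hb t ht).const_mul 2).sub (hasDerivAt_id t)).add
    ((hat.const_add (2 * n + 1 + s)).mul hat)).div (hasDerivAt_id t) ht.ne'
  have h3 : deriv (deriv a) t = _ := hd.deriv_eq.trans h2.deriv
  rw [h3, hat.deriv]
  simp only [Pi.add_apply, Pi.sub_apply, Pi.mul_apply, id]
  have := ha0 t ht
  have := ht.ne'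
  field_simp
  ring

section Painleve

variable {s : ℝ} {h A B : ℕ → ℝ → ℝ}

theorem hasDerivAt_riccati_diag (hs : 0 < s)
    (H : ∀ t > 0, IsMonicOrthogonal s t (orthoPoly s t) (h · t)) {k : ℕ}
    (hrec : ∀ t > 0, X * orthoPoly s t (k + 1) = orthoPoly s t (k + 2)
      + C (A (k + 1) t) * orthoPoly s t (k + 1) + C (B (k + 1) t) * orthoPoly s t k)
    {a b : ℝ → ℝ} (haA : ∀ t, A (k + 1) t = 2 * (k + 1 : ℝ) + 1 + s + a t)
    (ha : ∀ t > 0, a t * h (k + 1) t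
      = t * momentFunctional (s - 1) t (orthoPoly s t (k + 1) * orthoPoly s t (k + 1)))
    (hb : ∀ t > 0, b t * h k t
      = t * momentFunctional (s - 1) t (orthoPoly s t (k + 1) * orthoPoly s t k))
    {t : ℝ} (ht : 0 < t) :
    HasDerivAt a ((2 * b t - t + (2 * (k + 1 : ℝ) + 1 + s + a t) * a t) / t) t := by
  have hs' : -1 < s := by linarith
  have key := ((hasDerivAt_coeff hs' H ht k).sub (hasDerivAt_coeff hs' H ht (k + 1))).sub_const
    (2 * (k + 1 : ℝ) + 1 + s)
  have heq : a =ᶠ[𝓝 t] fun u => (orthoPoly s u (k + 1)).coeff k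
      - (orthoPoly s u (k + 2)).coeff (k + 1) - (2 * (k + 1 : ℝ) + 1 + s) := by
    filter_upwards [Ioi_mem_nhds ht] with u hu
    have := (H u hu).diag_eq_coeff_sub (A := (A · u)) (B := (B · u)) (hrec u hu)
    linarith [haA u]
  refine (key.congr_of_eventuallyEq heq).congr_deriv ?_
  have e1 := (H t ht).mixed_inverse_moment_succ (A := (A · t)) (B := (B · t)) (hrec t ht)
  have e2 := (H t ht).offDiag_mul_norm_eq (A := (A · t)) (B := (B · t)) (hrec t ht)
  have p0 := (H t ht).pos k
  have p1 := (H t ht).pos (k + 1)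
  have hA := haA t
  have ha := ha t ht
  have hb := hb t ht
  rw [← hA]
  have e3 : momentFunctional (s - 1) t (orthoPoly s t (k + 1) * orthoPoly s t k)
      = b t * h k t / t := by
    field_simp
    linarith
  have e4 : momentFunctional (s - 1) t (orthoPoly s t (k + 1) * orthoPoly s t (k + 1))
      = a t * h (k + 1) t / t := by
    field_simp
    linarith
  have e5 : momentFunctional (s - 1) t (orthoPoly s t (k + 1 + 1) * orthoPoly s t (k + 1))
      = h (k + 1) t * (t - A (k + 1) t * a t - b t) / t := by
    rw [e1, e3, e4]
    field_simp
    linear_combination -b t * e2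
  rw [e3, e5]
  field_simp
  ring

theorem hasDerivAt_riccati_mixed (hs : 0 < s)
    (H : ∀ t > 0, IsMonicOrthogonal s t (orthoPoly s t) (h · t)) {k : ℕ} {a b : ℝ → ℝ}
    (ha : ∀ t > 0, a t * h (k + 1) t
      = t * momentFunctional (s - 1) t (orthoPoly s t (k + 1) * orthoPoly s t (k + 1)))
    (hb : ∀ t > 0, b t * h k t
      = t * momentFunctional (s - 1) t (orthoPoly s t (k + 1) * orthoPoly s t k))
    {t : ℝ} (ht : 0 < t) (ha0 : a t ≠ 0) :
    HasDerivAt b ((b t + 2 * (b t ^ 2 - t * b t) / a t - (k + 1 : ℝ) * t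
      + (2 * (k + 1 : ℝ) + s) * b t) / t) t := by
  have hs' : -1 < s := by linarith
  have p0 := (H t ht).pos k
  have p1 := (H t ht).pos (k + 1)
  have key := ((hasDerivAt_norm hs' H ht (k + 1)).div (hasDerivAt_norm hs' H ht k) p0.ne').add
    (hasDerivAt_coeff hs' H ht k)
  have heq : b =ᶠ[𝓝 t] fun u => h (k + 1) u / h k u + (orthoPoly s u (k + 1)).coeff k := by
    filter_upwards [Ioi_mem_nhds ht] with u hu
    have e1 := (H u hu).norm_ratio hs (le_of_lt hu) k
    have e2 := hb u hu
    have q0 := (H u hu).pos k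
    field_simp
    linarith
  refine (key.congr_of_eventuallyEq heq).congr_deriv ?_
  have e1 := (H t ht).sum_relation hs ht.le k
  have e2 := (H t ht).product_relation k
  have ha := ha t ht
  have hb := hb t ht
  generalize momentFunctional (s - 1) t (orthoPoly s t (k + 1) * orthoPoly s t k) = W at *
  generalize momentFunctional (s - 1) t (orthoPoly s t k * orthoPoly s t k) = Q at *
  generalize momentFunctional (s - 1) t (orthoPoly s t (k + 1) * orthoPoly s t (k + 1)) = R at *
  have hb' : b t = t * W / h k t := by
    field_simp
    linarith
  have ha' : R = a t * h (k + 1) t / t := by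
    field_simp
    linarith
  have e3 : 2 * (b t ^ 2 - t * b t) / a t = 2 * t * h (k + 1) t * Q / h k t ^ 2 := by
    rw [hb']
    rw [ha'] at e2
    field_simp
    field_simp at e2
    linear_combination e2
  rw [e3, hb']
  field_simp
  linear_combination -e1

theorem tendsto_inverse_moment_div_norm (hs : 0 < s)
    (H : ∀ t > 0, IsMonicOrthogonal s t (orthoPoly s t) (h · t)) (n : ℕ) :
    Tendsto (fun t => momentFunctional (s - 1) t (orthoPoly s t n * orthoPoly s t n) / h n t)
      (𝓝[>] 0) (𝓝 (1 / s)) := by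
  have hs' : -1 < s := by linarith
  have hc := continuousOn_coeff_orthoPoly hs' n
  have hcd : ∀ i, ContinuousOn (fun t => (derivative (orthoPoly s t n)).coeff i) (Ici 0) := by
    intro i
    simp only [coeff_derivative]
    exact (hc (i + 1)).mul continuousOn_const
  have hN : ∀ t, (orthoPoly s t n * orthoPoly s t n).natDegree ≤ n + n := by
    intro t
    simpa [natDegree_orthoPoly] using
      natDegree_mul_le (p := orthoPoly s t n) (q := orthoPoly s t n)
  have hNd : ∀ t, (orthoPoly s t n * derivative (orthoPoly s t n)).natDegree ≤ n + n := by
    intro t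
    refine natDegree_mul_le.trans ?_
    have := natDegree_derivative_le (orthoPoly s t n)
    rw [natDegree_orthoPoly] at this ⊢
    omega
  have c1 := continuousOn_momentFunctional (s := s - 1) (by linarith) hN
    (continuousOn_coeff_mul hc hc)
  have c0 := continuousOn_momentFunctional hs' hN (continuousOn_coeff_mul hc hc)
  have cd := continuousOn_momentFunctional hs' hNd (continuousOn_coeff_mul hc hcd)
  have hlim : ∀ {f : ℝ → ℝ}, ContinuousOn f (Ici 0) → Tendsto f (𝓝[>] 0) (𝓝 (f 0)) :=
    fun hf => (hf 0 self_mem_Ici).tendsto.mono_left (nhdsWithin_mono 0 Ioi_subset_Ici_self)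
  have horth : momentFunctional s 0 (orthoPoly s 0 n * derivative (orthoPoly s 0 n)) = 0 := by
    refine tendsto_nhds_unique (hlim cd) (tendsto_const_nhds.congr' ?_)
    filter_upwards [self_mem_nhdsWithin] with t ht
    exact ((H t ht).momentFunctional_mul_derivative_self n).symm
  have hpos := momentFunctional_orthoPoly_mul_self_pos hs' le_rfl n
  have hibp := momentFunctional_X_mul_derivative (s := s - 1) (by linarith) le_rfl
    (orthoPoly s 0 n * orthoPoly s 0 n)
  rw [momentFunctional_X_mul, sub_add_cancel, derivative_mul, map_add, mul_comm (derivative _),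
    horth] at hibp
  have hval : momentFunctional (s - 1) 0 (orthoPoly s 0 n * orthoPoly s 0 n)
      / momentFunctional s 0 (orthoPoly s 0 n * orthoPoly s 0 n) = 1 / s := by
    rw [div_eq_div_iff hpos.ne' hs.ne']
    linarith
  rw [← hval]
  refine ((hlim c1).div (hlim c0) hpos.ne').congr' ?_
  filter_upwards [self_mem_nhdsWithin] with t ht
  have := (H t ht).orth n n
  rw [if_pos rfl] at this
  rw [Pi.div_apply, this]

end Painleve

end

end PerturbedLaguerre

open PerturbedLaguerre

/-- Chen–Its: For every integer `n ≥ 1` and `α > 0`, the function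
`a_n(t) = α_n(t) - (2n+1+α)` is twice continuously differentiable on `(0,∞)` and
satisfies the Painlevé III equation
`a_n'' = (a_n')²/a_n - a_n'/t + (2n+1+α) a_n²/t² + a_n³/t² + α/t - 1/a_n`,
with `a_n(t) → 0` and `a_n(t)/t → 1/α` as `t → 0⁺`. -/
theorem chen_its_painleve_III
    (α : ℝ) (hα : 0 < α) (n : ℕ) (hn : 1 ≤ n)
    (P : ℕ → ℝ → ℝ → ℝ) (h : ℕ → ℝ → ℝ) (A B : ℕ → ℝ → ℝ)
    (hmonic : ∀ m : ℕ, ∀ τ > (0:ℝ), ∃ p : Polynomial ℝ,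
      p.Monic ∧ p.natDegree = m ∧ ∀ x, P m τ x = p.eval x)
    (horth : ∀ j k : ℕ, ∀ τ > (0:ℝ),
      (∫ x in Ioi (0:ℝ), P j τ x * P k τ x * (x ^ α * Real.exp (-x - τ / x)))
        = if j = k then h j τ else 0)
    (hpos : ∀ j : ℕ, ∀ τ > (0:ℝ), 0 < h j τ)
    (hrec : ∀ m : ℕ, 1 ≤ m → ∀ τ > (0:ℝ), ∀ x : ℝ,
      x * P m τ x = P (m + 1) τ x + A m τ * P m τ x + B m τ * P (m - 1) τ x) :
    ContDiffOn ℝ 2 (fun τ => A n τ - (2 * n + 1 + α)) (Ioi (0:ℝ)) ∧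
    (∀ t > (0:ℝ),
      deriv (deriv (fun τ => A n τ - (2 * n + 1 + α))) t
        = (deriv (fun τ => A n τ - (2 * n + 1 + α)) t) ^ 2 / (A n t - (2 * n + 1 + α))
          - deriv (fun τ => A n τ - (2 * n + 1 + α)) t / t
          + (2 * n + 1 + α) * (A n t - (2 * n + 1 + α)) ^ 2 / t ^ 2
          + (A n t - (2 * n + 1 + α)) ^ 3 / t ^ 2
          + α / t - 1 / (A n t - (2 * n + 1 + α))) ∧
    Tendsto (fun τ => A n τ - (2 * n + 1 + α)) (𝓝[>] (0:ℝ)) (𝓝 0) ∧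
    Tendsto (fun τ => (A n τ - (2 * n + 1 + α)) / τ) (𝓝[>] (0:ℝ)) (𝓝 (1 / α)) := by
  choose q hqm hqd hqe using hmonic
  have hα' : -1 < α := by linarith
  have H : ∀ t (ht : 0 < t), IsMonicOrthogonal α t (fun m => q m t ht) (h · t) := by
    intro t ht
    refine ⟨fun m => hqm m t ht, fun m => hqd m t ht, fun j k => ?_, fun j => hpos j t ht⟩
    rw [← (hasIntegral_momentFunctional hα' ht.le _).2, ← horth j k t ht]
    simp only [Polynomial.eval_mul, hqe _ t ht, weight]
  have hrecq : ∀ t (ht : 0 < t) (m : ℕ), Polynomial.X * q (m + 1) t ht = q (m + 2) t ht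
      + Polynomial.C (A (m + 1) t) * q (m + 1) t ht + Polynomial.C (B (m + 1) t) * q m t ht := by
    intro t ht m
    refine Polynomial.funext fun x => ?_
    have := hrec (m + 1) (by omega) t ht x
    simp only [hqe _ t ht, Nat.add_sub_cancel] at this
    simpa using this
  have hq : ∀ t (ht : 0 < t) m, q m t ht = orthoPoly α t m := fun t ht =>
    (H t ht).eq_orthoPoly (A := (A · t)) (B := (B · t)) (hrecq t ht)
  simp only [hq] at H hrecq
  obtain ⟨k, rfl⟩ : ∃ k, n = k + 1 := ⟨n - 1, by omega⟩
  push_cast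
  set a : ℝ → ℝ := fun τ => A (k + 1) τ - (2 * (k + 1 : ℝ) + 1 + α) with ha_def
  have haA : ∀ t, A (k + 1) t = 2 * (k + 1 : ℝ) + 1 + α + a t := fun t => by simp [ha_def]
  have ha : ∀ t > 0, a t * h (k + 1) t
      = t * momentFunctional (α - 1) t (orthoPoly α t (k + 1) * orthoPoly α t (k + 1)) := by
    intro t ht
    have e1 := (H t ht).diagonal_coeff hα ht.le (k + 1)
    have e2 := (H t ht).diag_mul_norm (A := (A · t)) (B := (B · t)) (hrecq t ht k)
    simp only [haA, Nat.cast_add, Nat.cast_one] at e1 e2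
    linarith
  have ha0 : ∀ t > 0, a t ≠ 0 := by
    intro t ht h0
    have e1 := ha t ht
    have e2 := mul_pos ht (momentFunctional_mul_self_pos (s := α - 1) (by linarith) ht.le
      ((H t ht).monic (k + 1)).ne_zero)
    rw [h0, zero_mul] at e1
    exact e2.ne e1
  have hb : ∀ t > 0, (t * momentFunctional (α - 1) t (orthoPoly α t (k + 1) * orthoPoly α t k)
      / h k t) * h k t
      = t * momentFunctional (α - 1) t (orthoPoly α t (k + 1) * orthoPoly α t k) :=
    fun t ht => div_mul_cancel₀ _ (hpos k t ht).ne'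
  obtain ⟨hC, hode⟩ := painleve_of_riccati
    (fun t ht => hasDerivAt_riccati_diag hα H (fun t ht => hrecq t ht k) haA ha hb ht)
    (fun t ht => hasDerivAt_riccati_mixed hα H ha hb ht (ha0 t ht)) ha0
  have hlim : Tendsto (fun τ => a τ / τ) (𝓝[>] 0) (𝓝 (1 / α)) := by
    refine (tendsto_inverse_moment_div_norm hα H (k + 1)).congr' ?_
    filter_upwards [self_mem_nhdsWithin] with t ht
    have ht' : t ≠ 0 := ne_of_gt ht
    have := hpos (k + 1) t ht
    have := ha t ht
    field_simp
    linarith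
  refine ⟨hC, hode, ?_, hlim⟩
  have hid : Tendsto (fun τ : ℝ => τ) (𝓝[>] 0) (𝓝 0) := nhdsWithin_le_nhds
  have := hid.mul hlim
  rw [zero_mul] at this
  refine this.congr' ?_
  filter_upwards [self_mem_nhdsWithin] with t ht
  exact mul_div_cancel₀ _ (ne_of_gt ht)
end

section
/- (Chen–Its) For every integer n ≥ 1 and every α > 0, the function H_n(t) = t (d/dt) ln D_n[w; t] is twice continuously differentiable on (0, ∞) and satisfies the Jimbo–Miwa–Okamoto σ-form (t H_n''(t))² = (n − (2n + α) H_n'(t))² − 4 (n(n + α) + t H_n'(t) − H_n(t)) H_n'(t) (H_n'(t) − 1) for all t > 0, with the initial conditions lim_{t→0⁺} H_n(t) = 0 and lim_{t→0⁺} H_n'(t) = −n/α. -/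
open MeasureTheory Set Filter Topology

/-- The singularly perturbed Laguerre weight `w(x; t, α) = x^α e^{-x - t/x}`. -/
noncomputable def pertLagWeight (α t x : ℝ) : ℝ := x ^ α * Real.exp (-x - t / x)

/-- The `j`-th moment `μ_j(t) = ∫_0^∞ x^j w(x; t, α) dx`. -/
noncomputable def pertLagMoment (α t : ℝ) (j : ℕ) : ℝ :=
  ∫ x in Set.Ioi (0:ℝ), x ^ j * pertLagWeight α t x

/-- The Hankel determinant `D_n[w; t] = det(μ_{j+k}(t))_{j,k=0}^{n-1}`. -/
noncomputable def hankelDet (α : ℝ) (n : ℕ) (t : ℝ) : ℝ :=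
  (Matrix.of (fun j k : Fin n => pertLagMoment α t (j.1 + k.1))).det

/-- `H_n(t) = t (d/dt) ln D_n[w; t]`. -/
noncomputable def Hlog (α : ℝ) (n : ℕ) (t : ℝ) : ℝ :=
  t * deriv (fun τ => Real.log (hankelDet α n τ)) t

section OrthogonalPolynomials

open Polynomial

/-- The linear functional on polynomials with moment sequence `m`. -/
noncomputable def momentFunctional (m : ℕ → ℝ) : ℝ[X] →ₗ[ℝ] ℝ :=
  Polynomial.lsum fun i => m i • LinearMap.id

theorem momentFunctional_monomial (m : ℕ → ℝ) (i : ℕ) (c : ℝ) :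
    momentFunctional m (monomial i c) = c * m i := by
  simp [momentFunctional, Polynomial.lsum_apply, Polynomial.sum_monomial_index, mul_comm]

theorem momentFunctional_C_mul (m : ℕ → ℝ) (c : ℝ) (p : ℝ[X]) :
    momentFunctional m (C c * p) = c * momentFunctional m p := by
  rw [← smul_eq_C_mul, map_smul, smul_eq_mul]

theorem momentFunctional_mul_eq_sum (m : ℕ → ℝ) {p q : ℝ[X]} {M N : ℕ} (hp : p.natDegree < M)
    (hq : q.natDegree < N) :
    momentFunctional m (p * q) = ∑ i ∈ Finset.range M, ∑ j ∈ Finset.range N,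
      p.coeff i * q.coeff j * m (i + j) := by
  conv_lhs => rw [p.as_sum_range' M hp, q.as_sum_range' N hq]
  simp [Finset.sum_mul_sum, monomial_mul_monomial, momentFunctional_monomial]

theorem momentFunctional_X_mul {m m' : ℕ → ℝ} (hm' : ∀ i, m' (i + 1) = m i) (p : ℝ[X]) :
    momentFunctional m' (X * p) = momentFunctional m p := by
  induction p using Polynomial.induction_on' with
  | add p q hp hq => rw [mul_add, map_add, map_add, hp, hq]
  | monomial i c => rw [X_mul_monomial, momentFunctional_monomial, momentFunctional_monomial, hm']

theorem momentFunctional_mul_divX {m m' : ℕ → ℝ} (hm' : ∀ i, m' (i + 1) = m i) (p q : ℝ[X]) :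
    momentFunctional m' (p * q)
      = momentFunctional m (p * q.divX) + q.coeff 0 * momentFunctional m' p := by
  conv_lhs => rw [← q.divX_mul_X_add]
  rw [show p * (q.divX * X + C (q.coeff 0)) = X * (p * q.divX) + C (q.coeff 0) * p by ring,
    map_add, momentFunctional_X_mul hm', momentFunctional_C_mul]

/-- The pair `(P_n, P_{n-1})` of consecutive monic orthogonal polynomials for the moment
sequence `m`, with `P_{-1} = 0`, built by the three-term recurrence. -/
noncomputable def orthPair (m : ℕ → ℝ) : ℕ → ℝ[X] × ℝ[X]
  | 0 => (1, 0)
  | n + 1 =>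
    let P := (orthPair m n).1
    let Q := (orthPair m n).2
    ((X - C (momentFunctional m (X * (P * P)) / momentFunctional m (P * P))) * P
      - C (momentFunctional m (P * P) / momentFunctional m (Q * Q)) * Q, P)

/-- The monic orthogonal polynomial of degree `n`. -/
noncomputable def orthPoly (m : ℕ → ℝ) (n : ℕ) : ℝ[X] := (orthPair m n).1

/-- The predecessor of `orthPoly m n`, which is `0` for `n = 0`. -/
noncomputable def orthPrev (m : ℕ → ℝ) (n : ℕ) : ℝ[X] := (orthPair m n).2

/-- The squared norm of `orthPoly m n`. -/
noncomputable def orthNorm (m : ℕ → ℝ) (n : ℕ) : ℝ :=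
  momentFunctional m (orthPoly m n * orthPoly m n)

/-- The squared norm of `orthPrev m n`. -/
noncomputable def orthNormPrev (m : ℕ → ℝ) (n : ℕ) : ℝ :=
  momentFunctional m (orthPrev m n * orthPrev m n)

/-- The diagonal recurrence coefficient. -/
noncomputable def recDiag (m : ℕ → ℝ) (n : ℕ) : ℝ :=
  momentFunctional m (X * (orthPoly m n * orthPoly m n)) / orthNorm m n

/-- The off-diagonal recurrence coefficient. -/
noncomputable def recOff (m : ℕ → ℝ) (n : ℕ) : ℝ := orthNorm m n / orthNormPrev m n

theorem orthPoly_zero (m : ℕ → ℝ) : orthPoly m 0 = 1 := rfl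

theorem orthPrev_zero (m : ℕ → ℝ) : orthPrev m 0 = 0 := rfl

theorem orthPrev_succ (m : ℕ → ℝ) (n : ℕ) : orthPrev m (n + 1) = orthPoly m n := rfl

theorem orthNormPrev_succ (m : ℕ → ℝ) (n : ℕ) : orthNormPrev m (n + 1) = orthNorm m n := rfl

theorem recOff_zero (m : ℕ → ℝ) : recOff m 0 = 0 := by
  simp [recOff, orthNormPrev, orthPrev_zero]

theorem orthPoly_succ (m : ℕ → ℝ) (n : ℕ) :
    orthPoly m (n + 1) = (X - C (recDiag m n)) * orthPoly m n - C (recOff m n) * orthPrev m n :=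
  rfl

theorem orthPoly_degree_aux (m : ℕ → ℝ) (n : ℕ) :
    (orthPoly m n).Monic ∧ (orthPoly m n).degree = n ∧ (orthPrev m n).degree < n := by
  induction n with
  | zero => simp [orthPoly_zero, orthPrev_zero]
  | succ n ih =>
    obtain ⟨h1, h2, h3⟩ := ih
    have hd : ((X - C (recDiag m n)) * orthPoly m n).degree = ((n + 1 : ℕ) : WithBot ℕ) := by
      rw [degree_mul, degree_X_sub_C, h2]; push_cast; ring
    have hlt : (C (recOff m n) * orthPrev m n).degree
        < ((X - C (recDiag m n)) * orthPoly m n).degree := by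
      rw [hd]
      rw [← smul_eq_C_mul]
      refine lt_of_le_of_lt (degree_smul_le _ _) (h3.trans ?_)
      exact_mod_cast Nat.lt_succ_self n
    refine ⟨?_, ?_, ?_⟩
    · rw [orthPoly_succ]
      exact ((monic_X_sub_C _).mul h1).sub_of_left hlt
    · rw [orthPoly_succ, degree_sub_eq_left_of_degree_lt hlt, hd]
    · rw [orthPrev_succ, h2]
      exact_mod_cast Nat.lt_succ_self n

theorem orthPoly_monic (m : ℕ → ℝ) (n : ℕ) : (orthPoly m n).Monic := (orthPoly_degree_aux m n).1

theorem orthPoly_degree (m : ℕ → ℝ) (n : ℕ) : (orthPoly m n).degree = n :=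
  (orthPoly_degree_aux m n).2.1

theorem orthPrev_degree_lt (m : ℕ → ℝ) (n : ℕ) : (orthPrev m n).degree < n :=
  (orthPoly_degree_aux m n).2.2

theorem orthPoly_natDegree (m : ℕ → ℝ) (n : ℕ) : (orthPoly m n).natDegree = n :=
  natDegree_eq_of_degree_eq_some (orthPoly_degree m n)

theorem orthPoly_degree_lt (m : ℕ → ℝ) (n : ℕ) : (orthPoly m n).degree < (n + 1 : ℕ) := by
  rw [orthPoly_degree]; exact_mod_cast Nat.lt_succ_self n

theorem orthPoly_coeff_self (m : ℕ → ℝ) (n : ℕ) : (orthPoly m n).coeff n = 1 := by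
  have h := orthPoly_monic m n
  rwa [Monic, leadingCoeff, orthPoly_natDegree] at h

theorem orthPoly_coeff_of_lt (m : ℕ → ℝ) {n i : ℕ} (h : n < i) : (orthPoly m n).coeff i = 0 :=
  coeff_eq_zero_of_natDegree_lt (by rwa [orthPoly_natDegree])

theorem orthPrev_natDegree_lt (m : ℕ → ℝ) (n : ℕ) : (orthPrev m n).natDegree < n + 1 := by
  have := natDegree_le_of_degree_le (orthPrev_degree_lt m n).le
  lia

/-- A moment sequence is positive definite if its functional is positive on squares. -/
def PosDefMoments (m : ℕ → ℝ) : Prop := ∀ p : ℝ[X], p ≠ 0 → 0 < momentFunctional m (p * p)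

theorem orthNorm_pos {m : ℕ → ℝ} (hm : PosDefMoments m) (n : ℕ) : 0 < orthNorm m n :=
  hm _ (orthPoly_monic m n).ne_zero

theorem degree_sub_coeff_mul_orthPoly_lt (m : ℕ → ℝ) {n : ℕ} {p : ℝ[X]}
    (hp : p.degree < (n + 1 : ℕ)) : (p - C (p.coeff n) * orthPoly m n).degree < n := by
  rw [degree_lt_iff_coeff_zero] at hp ⊢
  intro i hi
  rw [coeff_sub, coeff_C_mul]
  rcases hi.eq_or_lt with rfl | hi
  · rw [orthPoly_coeff_self, mul_one, sub_self]
  · rw [hp i hi, orthPoly_coeff_of_lt m hi, mul_zero, sub_zero]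

theorem momentFunctional_orthPoly_mul_aux {m : ℕ → ℝ} (hm : PosDefMoments m) (n : ℕ) :
    (∀ p : ℝ[X], p.degree < (n + 1 : ℕ) →
      momentFunctional m (orthPoly m n * p) = p.coeff n * orthNorm m n) ∧
    (∀ p : ℝ[X], p.degree < n →
      momentFunctional m (orthPrev m n * p) = p.coeff (n - 1) * orthNormPrev m n) := by
  induction n with
  | zero =>
    constructor
    · intro p hp
      have h0 : p = C (p.coeff 0) := eq_C_of_natDegree_eq_zero (by
        by_contra h
        have h1 := (natDegree_lt_iff_degree_lt (by rintro rfl; simp at h)).2 hp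
        lia)
      rw [h0, mul_comm, momentFunctional_C_mul, orthNorm, orthPoly_zero, coeff_C_zero, one_mul]
    · intro p hp
      have : p = 0 := by simpa [Nat.WithBot.lt_zero_iff] using hp
      simp [this]
  | succ n ih =>
    obtain ⟨ih1, ih2⟩ := ih
    refine ⟨?_, fun p hp => by simpa [orthPrev_succ, orthNormPrev_succ] using ih1 p hp⟩
    have hpos := orthNorm_pos hm n
    have hexp : ∀ q, momentFunctional m (orthPoly m (n + 1) * q)
        = momentFunctional m (orthPoly m n * (X * q))
          - recDiag m n * momentFunctional m (orthPoly m n * q)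
          - recOff m n * momentFunctional m (orthPrev m n * q) := by
      intro q
      rw [orthPoly_succ, show ((X - C (recDiag m n)) * orthPoly m n
        - C (recOff m n) * orthPrev m n) * q = orthPoly m n * (X * q)
          - C (recDiag m n) * (orthPoly m n * q) - C (recOff m n) * (orthPrev m n * q) by ring]
      simp only [map_sub, momentFunctional_C_mul]
    have hself : momentFunctional m (orthPoly m (n + 1) * orthPoly m n) = 0 := by
      rw [hexp, mul_comm (orthPrev m n),
        ih1 _ ((orthPrev_degree_lt m n).trans (by exact_mod_cast Nat.lt_succ_self n)),
        coeff_eq_zero_of_degree_lt (orthPrev_degree_lt m n), recDiag,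
        show orthPoly m n * (X * orthPoly m n) = X * (orthPoly m n * orthPoly m n) by ring,
        ← orthNorm]
      field_simp
      ring
    have hlow : ∀ q : ℝ[X], q.degree < n → momentFunctional m (orthPoly m (n + 1) * q) = 0 := by
      intro q hq
      rcases n with _ | n
      · have : q = 0 := by simpa [Nat.WithBot.lt_zero_iff] using hq
        simp [this]
      · have hX : (X * q).degree < ((n + 1 + 1 : ℕ) : WithBot ℕ) := by
          rw [degree_lt_iff_coeff_zero] at hq ⊢
          intro i hi
          obtain ⟨j, rfl⟩ : ∃ j, i = j + 1 := ⟨i - 1, by lia⟩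
          rw [coeff_X_mul]
          exact hq j (by lia)
        rw [hexp, ih1 _ hX, ih1 q (hq.trans (by exact_mod_cast Nat.lt_succ_self _)), ih2 q hq,
          coeff_X_mul, coeff_eq_zero_of_degree_lt hq, recOff, orthNormPrev_succ]
        have := (orthNorm_pos hm n).ne'
        simp only [Nat.add_sub_cancel]
        field_simp
        ring
    intro p hp
    have hq := degree_sub_coeff_mul_orthPoly_lt m hp
    set q := p - C (p.coeff (n + 1)) * orthPoly m (n + 1) with hqdef
    have hr := degree_sub_coeff_mul_orthPoly_lt m hq
    have hp' : orthPoly m (n + 1) * p = C (p.coeff (n + 1)) * (orthPoly m (n + 1)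
        * orthPoly m (n + 1)) + (C (q.coeff n) * (orthPoly m (n + 1) * orthPoly m n)
        + orthPoly m (n + 1) * (q - C (q.coeff n) * orthPoly m n)) := by
      rw [hqdef]; ring
    rw [hp', map_add, map_add, momentFunctional_C_mul, momentFunctional_C_mul, hself, hlow _ hr,
      orthNorm]
    ring

theorem momentFunctional_orthPoly_mul {m : ℕ → ℝ} (hm : PosDefMoments m) {n : ℕ} {p : ℝ[X]}
    (hp : p.degree < (n + 1 : ℕ)) :
    momentFunctional m (orthPoly m n * p) = p.coeff n * orthNorm m n :=
  (momentFunctional_orthPoly_mul_aux hm n).1 p hp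

theorem momentFunctional_orthPoly_mul_of_lt {m : ℕ → ℝ} (hm : PosDefMoments m) {n : ℕ} {p : ℝ[X]}
    (hp : p.degree < n) : momentFunctional m (orthPoly m n * p) = 0 := by
  rw [momentFunctional_orthPoly_mul hm (hp.trans (by exact_mod_cast Nat.lt_succ_self n)),
    coeff_eq_zero_of_degree_lt hp, zero_mul]

theorem momentFunctional_orthPoly_orthPoly {m : ℕ → ℝ} (hm : PosDefMoments m) {i j : ℕ}
    (hij : i ≠ j) : momentFunctional m (orthPoly m i * orthPoly m j) = 0 := by
  rcases lt_or_gt_of_ne hij with h | h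
  · rw [mul_comm]
    exact momentFunctional_orthPoly_mul_of_lt hm (by rw [orthPoly_degree]; exact_mod_cast h)
  · exact momentFunctional_orthPoly_mul_of_lt hm (by rw [orthPoly_degree]; exact_mod_cast h)

theorem hankel_det_eq_prod_orthNorm {m : ℕ → ℝ} (hm : PosDefMoments m) (n : ℕ) :
    (Matrix.of fun j k : Fin n => m (j.1 + k.1)).det = ∏ i ∈ Finset.range n, orthNorm m i := by
  set M : Matrix (Fin n) (Fin n) ℝ := Matrix.of fun j k => m (j.1 + k.1)
  set T : Matrix (Fin n) (Fin n) ℝ := Matrix.of fun i k => (orthPoly m i.1).coeff k.1 with hT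
  have hdet : T.det = 1 := by
    rw [Matrix.det_of_isLowerTriangular T (fun i j hij => orthPoly_coeff_of_lt m hij)]
    exact Finset.prod_eq_one fun i _ => orthPoly_coeff_self m i
  have hdiag : T * M * T.transpose = Matrix.diagonal fun i : Fin n => orthNorm m i := by
    ext i j
    have h := momentFunctional_mul_eq_sum m (p := orthPoly m i) (q := orthPoly m j)
      (M := n) (N := n) (by rw [orthPoly_natDegree]; exact i.2)
      (by rw [orthPoly_natDegree]; exact j.2)
    have h' : (T * M * T.transpose) i j
        = momentFunctional m (orthPoly m i * orthPoly m j) := by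
      rw [h]
      simp only [Matrix.mul_apply, Matrix.transpose_apply, hT, M, Matrix.of_apply,
        Finset.sum_range, Finset.sum_mul]
      rw [Finset.sum_comm]
      refine Finset.sum_congr rfl fun a _ => Finset.sum_congr rfl fun b _ => by ring
    rw [h']
    by_cases hij : i = j
    · subst hij; rw [Matrix.diagonal_apply_eq, orthNorm]
    · rw [Matrix.diagonal_apply_ne _ hij]
      exact momentFunctional_orthPoly_orthPoly hm fun h => hij (Fin.ext h)
  have := congrArg Matrix.det hdiag
  rwa [Matrix.det_mul, Matrix.det_mul, Matrix.det_transpose, hdet, one_mul, mul_one,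
    Matrix.det_diagonal, Fin.prod_univ_eq_prod_range (fun i => orthNorm m i)] at this

/-- The subleading coefficient is minus the sum of the diagonal recurrence coefficients. -/
theorem orthPoly_succ_coeff (m : ℕ → ℝ) (n : ℕ) :
    (orthPoly m (n + 1)).coeff n = -∑ j ∈ Finset.range (n + 1), recDiag m j := by
  induction n with
  | zero => simp [orthPoly_succ, orthPoly_zero, orthPrev_zero]
  | succ n ih =>
    rw [Finset.sum_range_succ, orthPoly_succ, sub_mul, coeff_sub, coeff_sub, coeff_X_mul,
      coeff_C_mul, coeff_C_mul, ih, orthPoly_coeff_self,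
      coeff_eq_zero_of_degree_lt (orthPrev_degree_lt m (n + 1))]
    ring


/-- The matrix element of `1/x` between `orthPoly m n` and itself, normalised. -/
noncomputable def invDiag (m m' : ℕ → ℝ) (n : ℕ) : ℝ :=
  momentFunctional m' (orthPoly m n * orthPoly m n) / orthNorm m n

/-- The matrix element of `1/x` between `orthPrev m n` and itself, normalised. -/
noncomputable def invDiagPrev (m m' : ℕ → ℝ) (n : ℕ) : ℝ :=
  momentFunctional m' (orthPrev m n * orthPrev m n) / orthNormPrev m n

/-- The matrix element of `1/x` between `orthPoly m n` and `orthPrev m n`, normalised. -/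
noncomputable def invOff (m m' : ℕ → ℝ) (n : ℕ) : ℝ :=
  momentFunctional m' (orthPoly m n * orthPrev m n) / orthNormPrev m n

theorem invOff_zero (m m' : ℕ → ℝ) : invOff m m' 0 = 0 := by
  simp [invOff, orthPrev_zero]

theorem invDiagPrev_succ (m m' : ℕ → ℝ) (n : ℕ) : invDiagPrev m m' (n + 1) = invDiag m m' n := rfl

theorem invOff_succ_add {m m' : ℕ → ℝ} (hm : PosDefMoments m) (hm' : ∀ i, m' (i + 1) = m i)
    (n : ℕ) : invOff m m' (n + 1) + recDiag m n * invDiag m m' n + invOff m m' n = 1 := by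
  have hpos := (orthNorm_pos hm n).ne'
  have h : orthNorm m n = momentFunctional m' (orthPoly m (n + 1) * orthPoly m n)
      + recDiag m n * momentFunctional m' (orthPoly m n * orthPoly m n)
      + recOff m n * momentFunctional m' (orthPoly m n * orthPrev m n) := by
    rw [orthNorm, ← momentFunctional_X_mul hm', orthPoly_succ,
      ← momentFunctional_C_mul, ← momentFunctional_C_mul, ← map_add, ← map_add]
    congr 1
    ring
  have h3 : invOff m m' n
      = recOff m n * momentFunctional m' (orthPoly m n * orthPrev m n) / orthNorm m n := by
    rcases n with _ | n
    · simp [invOff, orthPrev_zero]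
    · have := (orthNorm_pos hm n).ne'
      rw [invOff, recOff, orthNormPrev_succ]
      field_simp
  rw [h3, invOff, invDiag, orthNormPrev_succ, orthPrev_succ]
  field_simp
  linarith

theorem divX_coeff_orthPoly_succ (m : ℕ → ℝ) (n : ℕ) : (orthPoly m (n + 1)).divX.coeff n = 1 := by
  rw [coeff_divX, orthPoly_coeff_self]

theorem degree_divX_orthPoly_lt (m : ℕ → ℝ) (n : ℕ) :
    (orthPoly m n).divX.degree < n := by
  rw [degree_lt_iff_coeff_zero]
  intro i hi
  rw [coeff_divX, orthPoly_coeff_of_lt m (by lia)]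

theorem recOff_mul_invDiag_mul_invDiag {m m' : ℕ → ℝ} (hm : PosDefMoments m)
    (hm' : ∀ i, m' (i + 1) = m i) (n : ℕ) :
    recOff m (n + 1) * invDiag m m' (n + 1) * invDiag m m' n
      = invOff m m' (n + 1) ^ 2 - invOff m m' (n + 1) := by
  have hn := (orthNorm_pos hm n).ne'
  have hn1 := (orthNorm_pos hm (n + 1)).ne'
  have e1 := momentFunctional_mul_divX hm' (orthPoly m (n + 1)) (orthPoly m (n + 1))
  have e2 := momentFunctional_mul_divX hm' (orthPoly m n) (orthPoly m n)
  have e3 := momentFunctional_mul_divX hm' (orthPoly m (n + 1)) (orthPoly m n)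
  have e4 := momentFunctional_mul_divX hm' (orthPoly m n) (orthPoly m (n + 1))
  rw [momentFunctional_orthPoly_mul_of_lt hm (degree_divX_orthPoly_lt m _)] at e1 e2
  rw [momentFunctional_orthPoly_mul_of_lt hm ((degree_divX_orthPoly_lt m n).trans
    (by exact_mod_cast Nat.lt_succ_self n))] at e3
  rw [momentFunctional_orthPoly_mul hm (degree_divX_orthPoly_lt m (n + 1)),
    divX_coeff_orthPoly_succ, mul_comm (orthPoly m n)] at e4
  rw [recOff, invDiag, invDiag, invOff, orthNormPrev_succ, orthPrev_succ]
  field_simp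
  rw [e1, e2]
  linear_combination (-momentFunctional m' (orthPoly m (n + 1) * orthPoly m n) + orthNorm m n) * e3
    - (orthPoly m n).coeff 0 * momentFunctional m' (orthPoly m (n + 1)) * e4

/-- The moment form of Pearson's equation for the weight `x^α e^{-x-t/x}`. -/
theorem momentFunctional_pearson {m m' : ℕ → ℝ} {α t : ℝ}
    (h : ∀ i : ℕ, (i + 1 + α) * m i - m (i + 1) + t * m' i = 0) (p : ℝ[X]) :
    momentFunctional m (X * derivative p) + (1 + α) * momentFunctional m p
      - momentFunctional m (X * p) + t * momentFunctional m' p = 0 := by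
  induction p using Polynomial.induction_on' with
  | add p q hp hq => simp only [mul_add, map_add]; linear_combination hp + hq
  | monomial i c =>
    have hX : (X : ℝ[X]) * derivative (monomial i c) = monomial i (c * i) := by
      rw [derivative_monomial]
      rcases i with _ | i
      · simp
      · rw [X_mul_monomial, Nat.add_sub_cancel]
    rw [hX, X_mul_monomial]
    simp only [momentFunctional_monomial]
    linear_combination c * h i

theorem degree_X_mul_derivative_lt {p : ℝ[X]} {n : ℕ} (hp : p.degree < n) :
    (X * derivative p).degree < (n : WithBot ℕ) := by
  rw [degree_lt_iff_coeff_zero] at hp ⊢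
  intro i hi
  rcases i with _ | i
  · simp
  · rw [coeff_X_mul, coeff_derivative, hp _ hi, zero_mul]

theorem coeff_X_mul_derivative (p : ℝ[X]) (n : ℕ) :
    (X * derivative p).coeff n = n * p.coeff n := by
  rcases n with _ | n
  · simp
  · rw [coeff_X_mul, coeff_derivative]; push_cast; ring

theorem recDiag_eq {m m' : ℕ → ℝ} {α t : ℝ} (hm : PosDefMoments m)
    (h : ∀ i : ℕ, (i + 1 + α) * m i - m (i + 1) + t * m' i = 0) (n : ℕ) :
    recDiag m n = 2 * n + 1 + α + t * invDiag m m' n := by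
  have hpos := (orthNorm_pos hm n).ne'
  have e := momentFunctional_pearson h (orthPoly m n * orthPoly m n)
  rw [derivative_mul, show X * (derivative (orthPoly m n) * orthPoly m n
      + orthPoly m n * derivative (orthPoly m n))
      = C 2 * (orthPoly m n * (X * derivative (orthPoly m n))) by
        rw [show (C 2 : ℝ[X]) = 2 from rfl]; ring,
    momentFunctional_C_mul, momentFunctional_orthPoly_mul hm
      (degree_X_mul_derivative_lt (orthPoly_degree_lt m n)), coeff_X_mul_derivative,
    orthPoly_coeff_self, ← orthNorm] at e
  rw [recDiag, invDiag]
  field_simp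
  linarith

theorem recOff_succ_eq {m m' : ℕ → ℝ} {α t : ℝ} (hm : PosDefMoments m)
    (h : ∀ i : ℕ, (i + 1 + α) * m i - m (i + 1) + t * m' i = 0) (n : ℕ) :
    recOff m (n + 1) = ∑ j ∈ Finset.range (n + 1), recDiag m j + t * invOff m m' (n + 1) := by
  have hpos := (orthNorm_pos hm n).ne'
  have e := momentFunctional_pearson h (orthPoly m (n + 1) * orthPoly m n)
  have hdeg : (X * derivative (orthPoly m (n + 1)) - C ((n + 1 : ℕ) : ℝ) * orthPoly m (n + 1)).degree
      < ((n + 1 : ℕ) : WithBot ℕ) := by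
    have := degree_sub_coeff_mul_orthPoly_lt m
      (degree_X_mul_derivative_lt (orthPoly_degree_lt m (n + 1)))
    rwa [coeff_X_mul_derivative, orthPoly_coeff_self, mul_one] at this
  have e1 : momentFunctional m (orthPoly m n * (X * derivative (orthPoly m (n + 1))))
      = (∑ j ∈ Finset.range (n + 1), recDiag m j) * orthNorm m n := by
    have := momentFunctional_orthPoly_mul hm hdeg
    rw [mul_sub, map_sub, mul_left_comm (orthPoly m n) (C _), momentFunctional_C_mul,
      momentFunctional_orthPoly_orthPoly hm (by lia : n ≠ n + 1), coeff_sub, coeff_C_mul,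
      coeff_X_mul_derivative, orthPoly_succ_coeff] at this
    rw [← sub_zero (momentFunctional m _), ← mul_zero ((n + 1 : ℕ) : ℝ), this]
    push_cast
    ring
  have e2 : momentFunctional m (orthPoly m (n + 1) * (X * derivative (orthPoly m n))) = 0 :=
    momentFunctional_orthPoly_mul_of_lt hm (degree_X_mul_derivative_lt (orthPoly_degree_lt m n))
  have e3 : momentFunctional m (orthPoly m (n + 1) * (X * orthPoly m n)) = orthNorm m (n + 1) := by
    have hX : (X * orthPoly m n).degree < ((n + 1 + 1 : ℕ) : WithBot ℕ) := by
      rw [degree_mul, degree_X, orthPoly_degree]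
      norm_cast
      lia
    rw [momentFunctional_orthPoly_mul hm hX, coeff_X_mul, orthPoly_coeff_self, one_mul]
  rw [derivative_mul, show X * (derivative (orthPoly m (n + 1)) * orthPoly m n
      + orthPoly m (n + 1) * derivative (orthPoly m n))
      = orthPoly m n * (X * derivative (orthPoly m (n + 1)))
        + orthPoly m (n + 1) * (X * derivative (orthPoly m n)) by ring,
    show X * (orthPoly m (n + 1) * orthPoly m n) = orthPoly m (n + 1) * (X * orthPoly m n) by ring,
    map_add, e1, e2, e3, momentFunctional_orthPoly_orthPoly hm (by lia : n + 1 ≠ n)] at e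
  rw [recOff, invOff, orthNormPrev_succ, orthPrev_succ]
  field_simp
  linarith

theorem recOff_mul_invDiag_add {m m' : ℕ → ℝ} {α t : ℝ} (hm : PosDefMoments m)
    (hm' : ∀ i, m' (i + 1) = m i) (hpos' : ∀ n, invDiag m m' n ≠ 0)
    (h : ∀ i : ℕ, (i + 1 + α) * m i - m (i + 1) + t * m' i = 0) (n : ℕ) :
    recOff m n * (invDiag m m' n + invDiagPrev m m' n) = n - (2 * n + α) * invOff m m' n := by
  induction n with
  | zero => simp [recOff_zero, invOff_zero]
  | succ n ih =>
    have f1 := invOff_succ_add hm hm' n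
    have f2 := recOff_mul_invDiag_mul_invDiag hm hm' n
    have f3 := recDiag_eq hm h n
    have f4 := recOff_succ_eq hm h n
    have f2' : recOff m n * invDiag m m' n * invDiagPrev m m' n
        = invOff m m' n ^ 2 - invOff m m' n := by
      rcases n with _ | n
      · simp [recOff_zero, invOff_zero]
      · exact recOff_mul_invDiag_mul_invDiag hm hm' n
    have f4' : recOff m n = ∑ j ∈ Finset.range n, recDiag m j + t * invOff m m' n := by
      rcases n with _ | n
      · simp [recOff_zero, invOff_zero]
      · exact recOff_succ_eq hm h n
    rw [Finset.sum_range_succ] at f4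
    have hρ := hpos' n
    have key : recOff m (n + 1) * invDiag m m' (n + 1) - recOff m n * invDiagPrev m m' n
        = -(invOff m m' (n + 1) - invOff m m' n) * recDiag m n := by
      apply mul_left_cancel₀ hρ
      linear_combination f2 - f2' + (invOff m m' (n + 1) - invOff m m' n) * f1
    rw [invDiagPrev_succ]
    push_cast
    generalize recOff m (n + 1) = b1 at *
    generalize recOff m n = b0 at *
    generalize invDiag m m' (n + 1) = r1 at *
    generalize invDiag m m' n = r0 at *
    generalize invDiagPrev m m' n = s0 at *
    generalize invOff m m' (n + 1) = q1 at *
    generalize invOff m m' n = q0 at *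
    generalize recDiag m n = a at *
    linear_combination key + ih + r0 * (f4 - f4') - (q1 - q0) * f3 + f1

theorem invOff_succ_of_gamma {m m' : ℕ → ℝ} {α : ℝ} (hm : PosDefMoments m)
    (hm' : ∀ i, m' (i + 1) = m i) (hα : α ≠ 0) (h : ∀ i : ℕ, (i + α) * m' i = m i) (n : ℕ) :
    invOff m m' (n + 1) = -((n + 1 : ℕ) : ℝ) / α := by
  have hpos := (orthNorm_pos hm n).ne'
  have hp : ∀ p : ℝ[X], momentFunctional m (derivative p) + α * momentFunctional m' p
      = momentFunctional m p := by
    intro p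
    induction p using Polynomial.induction_on' with
    | add p q hp hq => simp only [map_add]; linear_combination hp + hq
    | monomial i c =>
      rw [derivative_monomial]
      simp only [momentFunctional_monomial]
      rcases i with _ | i
      · linear_combination c * h 0
      · rw [Nat.add_sub_cancel, ← hm' i]
        linear_combination c * h (i + 1)
  have e := hp (orthPoly m (n + 1) * orthPoly m n)
  have hd : ∀ k, (derivative (orthPoly m k)).degree < k := by
    intro k
    rw [degree_lt_iff_coeff_zero]
    intro i hi
    rw [coeff_derivative, orthPoly_coeff_of_lt m (by lia), zero_mul]
  rw [derivative_mul, map_add, mul_comm (derivative _),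
    momentFunctional_orthPoly_mul hm (hd (n + 1)), momentFunctional_orthPoly_mul_of_lt hm
      ((hd n).trans (by exact_mod_cast Nat.lt_succ_self n)),
    momentFunctional_orthPoly_orthPoly hm (by lia : n + 1 ≠ n), coeff_derivative,
    orthPoly_coeff_self] at e
  rw [invOff, orthNormPrev_succ, orthPrev_succ]
  field_simp
  push_cast
  linear_combination e

end OrthogonalPolynomials

section PerturbedMoments

/-- The moment `∫_0^∞ x^s e^{-x-t/x} dx` of real order `s`. -/
noncomputable def realMoment (s t : ℝ) : ℝ :=
  ∫ x in Ioi (0:ℝ), x ^ s * Real.exp (-x - t / x)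

theorem continuousOn_rpow_mul_exp (s t : ℝ) :
    ContinuousOn (fun x : ℝ => x ^ s * Real.exp (-x - t / x)) (Ioi 0) := by
  refine ContinuousOn.mul (fun x hx => ?_) ?_
  · exact (Real.continuousAt_rpow_const x s (Or.inl (ne_of_gt hx))).continuousWithinAt
  · refine Real.continuous_exp.comp_continuousOn (continuousOn_id.neg.sub ?_)
    exact continuousOn_const.div continuousOn_id fun x hx => ne_of_gt hx

theorem aestronglyMeasurable_rpow_mul_exp (s t : ℝ) :
    AEStronglyMeasurable (fun x : ℝ => x ^ s * Real.exp (-x - t / x))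
      (volume.restrict (Ioi 0)) :=
  (continuousOn_rpow_mul_exp s t).aestronglyMeasurable measurableSet_Ioi

theorem integrableOn_rpow_mul_exp_neg {s : ℝ} (hs : -1 < s) :
    IntegrableOn (fun x : ℝ => x ^ s * Real.exp (-x)) (Ioi 0) := by
  have := Real.GammaIntegral_convergent (s := s + 1) (by linarith)
  simpa [mul_comm] using this

theorem exp_neg_div_le {t x : ℝ} (ht : 0 < t) (hx : 0 < x) (n : ℕ) :
    Real.exp (-(t / x)) ≤ n.factorial / t ^ n * x ^ n := by
  have h := Real.pow_div_factorial_le_exp (t / x) (by positivity) n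
  rw [Real.exp_neg, inv_le_comm₀ (Real.exp_pos _) (by positivity)]
  refine le_trans (le_of_eq ?_) h
  rw [div_pow]
  field_simp

theorem rpow_mul_exp_le {t x : ℝ} (s : ℝ) (ht : 0 < t) (hx : 0 < x) (n : ℕ) :
    x ^ s * Real.exp (-x - t / x) ≤ n.factorial / t ^ n * (x ^ (s + n) * Real.exp (-x)) := by
  rw [Real.rpow_add hx, Real.rpow_natCast, sub_eq_add_neg, Real.exp_add]
  have h1 : 0 < x ^ s * Real.exp (-x) := by positivity
  have := mul_le_mul_of_nonneg_left (exp_neg_div_le ht hx n) h1.le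
  linarith

theorem integrableOn_rpow_mul_exp {s t : ℝ} (h : 0 < t ∨ 0 ≤ t ∧ -1 < s) :
    IntegrableOn (fun x : ℝ => x ^ s * Real.exp (-x - t / x)) (Ioi 0) := by
  rcases h with ht | ⟨ht, hs⟩
  · obtain ⟨n, hn⟩ := exists_nat_gt (-1 - s)
    refine Integrable.mono' ((integrableOn_rpow_mul_exp_neg (s := s + n) (by linarith)).const_mul
      (n.factorial / t ^ n)) (aestronglyMeasurable_rpow_mul_exp s t) ?_
    refine (ae_restrict_mem measurableSet_Ioi).mono fun x (hx : 0 < x) => ?_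
    rw [Real.norm_of_nonneg (by positivity)]
    exact rpow_mul_exp_le s ht hx n
  · refine Integrable.mono' (integrableOn_rpow_mul_exp_neg hs)
      (aestronglyMeasurable_rpow_mul_exp s t) ?_
    refine (ae_restrict_mem measurableSet_Ioi).mono fun x (hx : 0 < x) => ?_
    rw [Real.norm_of_nonneg (by positivity)]
    gcongr
    have : 0 ≤ t / x := by positivity
    linarith

theorem hasDerivAt_realMoment (s : ℝ) {t : ℝ} (ht : 0 < t) :
    HasDerivAt (realMoment s) (-realMoment (s - 1) t) t := by
  have hmem : Ioi (t / 2) ∈ 𝓝 t := Ioi_mem_nhds (by linarith)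
  have h := hasDerivAt_integral_of_dominated_loc_of_deriv_le (μ := volume.restrict (Ioi (0:ℝ)))
    (F := fun τ x => x ^ s * Real.exp (-x - τ / x))
    (F' := fun τ x => -(x ^ (s - 1) * Real.exp (-x - τ / x)))
    (bound := fun x => x ^ (s - 1) * Real.exp (-x - (t / 2) / x)) (x₀ := t) hmem
    (Eventually.of_forall fun τ => aestronglyMeasurable_rpow_mul_exp s τ)
    (integrableOn_rpow_mul_exp (Or.inl ht))
    (aestronglyMeasurable_rpow_mul_exp (s - 1) t).neg ?_
    (integrableOn_rpow_mul_exp (Or.inl (half_pos ht))) ?_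
  · have h2 := h.2
    rw [integral_neg] at h2
    exact h2
  · refine (ae_restrict_mem measurableSet_Ioi).mono fun x (hx : 0 < x) τ (hτ : t / 2 < τ) => ?_
    rw [norm_neg, Real.norm_of_nonneg (by positivity)]
    gcongr
  · refine (ae_restrict_mem measurableSet_Ioi).mono fun x (hx : 0 < x) τ _ => ?_
    have h1 : HasDerivAt (fun τ : ℝ => -x - τ / x) (-(1 / x)) τ :=
      ((hasDerivAt_id τ).div_const x).const_sub (-x)
    have h2 := (h1.exp).const_mul (x ^ s)
    refine h2.congr_deriv ?_
    rw [Real.rpow_sub_one hx.ne']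
    ring

theorem continuousWithinAt_realMoment {s : ℝ} (hs : -1 < s) :
    ContinuousWithinAt (realMoment s) (Ici 0) 0 := by
  refine continuousWithinAt_of_dominated (bound := fun x => x ^ s * Real.exp (-x))
    (Eventually.of_forall fun τ => aestronglyMeasurable_rpow_mul_exp s τ) ?_
    (integrableOn_rpow_mul_exp_neg hs) ?_
  · refine eventually_mem_nhdsWithin.mono fun τ (hτ : 0 ≤ τ) => ?_
    refine (ae_restrict_mem measurableSet_Ioi).mono fun x (hx : 0 < x) => ?_
    rw [Real.norm_of_nonneg (by positivity)]
    gcongr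
    have : 0 ≤ τ / x := by positivity
    linarith
  · refine Eventually.of_forall fun x => Continuous.continuousWithinAt ?_
    fun_prop

theorem realMoment_zero {s : ℝ} (hs : -1 < s) : realMoment s 0 = Real.Gamma (s + 1) := by
  rw [Real.Gamma_eq_integral (by linarith), realMoment]
  simp [mul_comm]

theorem tendsto_rpow_mul_exp_nhdsGT_zero (s : ℝ) {t : ℝ} (ht : 0 < t) :
    Tendsto (fun x : ℝ => x ^ s * Real.exp (-x - t / x)) (𝓝[>] 0) (𝓝 0) := by
  obtain ⟨n, hn⟩ := exists_nat_gt (-s)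
  have hpos : 0 < s + n := by linarith
  have hlim : Tendsto (fun x : ℝ => n.factorial / t ^ n * (x ^ (s + n) * Real.exp (-x)))
      (𝓝[>] 0) (𝓝 0) := by
    have hc : ContinuousAt (fun x : ℝ => n.factorial / t ^ n * (x ^ (s + n) * Real.exp (-x))) 0 :=
      continuousAt_const.mul ((Real.continuousAt_rpow_const 0 _ (Or.inr hpos.le)).mul
        (by fun_prop))
    have := hc.tendsto.mono_left (nhdsWithin_le_nhds (s := Ioi 0))
    simpa [Real.zero_rpow hpos.ne'] using this
  refine tendsto_of_tendsto_of_tendsto_of_le_of_le' tendsto_const_nhds hlim ?_ ?_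
  · refine eventually_mem_nhdsWithin.mono fun x (hx : 0 < x) => ?_
    positivity
  · exact eventually_mem_nhdsWithin.mono fun x (hx : 0 < x) => rpow_mul_exp_le s ht hx n

theorem realMoment_recurrence (s : ℝ) {t : ℝ} (ht : 0 < t) :
    (s + 1) * realMoment s t - realMoment (s + 1) t + t * realMoment (s - 1) t = 0 := by
  have hi : ∀ r : ℝ, IntegrableOn (fun x : ℝ => x ^ r * Real.exp (-x - t / x)) (Ioi 0) :=
    fun r => integrableOn_rpow_mul_exp (s := r) (Or.inl ht)
  set f' : ℝ → ℝ := fun x => (s + 1) * (x ^ s * Real.exp (-x - t / x))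
    - x ^ (s + 1) * Real.exp (-x - t / x) + t * (x ^ (s - 1) * Real.exp (-x - t / x)) with hf'
  have hd : ∀ x ∈ Ioi (0:ℝ),
      HasDerivAt (fun x : ℝ => x ^ (s + 1) * Real.exp (-x - t / x)) (f' x) x := by
    intro x (hx : 0 < x)
    have h1 : HasDerivAt (fun x : ℝ => -x - t / x) (-1 + t / x ^ 2) x := by
      have := (hasDerivAt_id x).neg.sub ((hasDerivAt_inv hx.ne').const_mul t)
      simp only [div_eq_mul_inv]
      refine this.congr_deriv ?_
      ring
    have h2 := (Real.hasDerivAt_rpow_const (p := s + 1) (Or.inl hx.ne')).mul h1.exp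
    refine h2.congr_deriv ?_
    simp only [hf']
    rw [add_sub_cancel_right, Real.rpow_sub_one hx.ne', Real.rpow_add_one hx.ne']
    field_simp
    ring
  have hint₁ : IntegrableOn (fun x : ℝ => (s + 1) * (x ^ s * Real.exp (-x - t / x))
      - x ^ (s + 1) * Real.exp (-x - t / x)) (Ioi 0) := ((hi s).const_mul _).sub (hi (s + 1))
  have hint : IntegrableOn f' (Ioi 0) := hint₁.add ((hi (s - 1)).const_mul t)
  have hval : ∫ x in Ioi (0:ℝ), f' x = 0 := by
    have htop := tendsto_zero_of_hasDerivAt_of_integrableOn_Ioi hd hint (hi (s + 1))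
    have hone : ∀ x ∈ Ioi (0:ℝ), HasDerivAt (fun _ : ℝ => (1:ℝ)) 0 x :=
      fun x _ => hasDerivAt_const x 1
    have := integral_Ioi_mul_deriv_eq_deriv_mul (u := fun _ : ℝ => (1:ℝ)) (u' := fun _ => 0)
      (v' := f') (a' := 0) (b' := 0) hone hd
      (by simpa [Pi.mul_def] using hint) (by simp [Pi.mul_def])
      (by simpa [Pi.mul_def] using tendsto_rpow_mul_exp_nhdsGT_zero (s + 1) ht)
      (by simpa [Pi.mul_def] using htop)
    simpa using this
  rw [← hval]
  simp only [hf']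
  rw [integral_add hint₁ ((hi (s - 1)).const_mul t), integral_sub ((hi s).const_mul _) (hi (s + 1)), integral_const_mul, integral_const_mul]
  rfl

theorem realMoment_zero_recurrence {s : ℝ} (hs : -1 < s) :
    (s + 1) * realMoment s 0 = realMoment (s + 1) 0 := by
  rw [realMoment_zero hs, realMoment_zero (by linarith), Real.Gamma_add_one (by linarith : s + 1 ≠ 0)]

end PerturbedMoments

section Regularity

open Polynomial

theorem contDiffWithinAt_momentFunctional_mul {k : WithTop ℕ∞} {S : Set ℝ} {t : ℝ}
    {m : ℝ → ℕ → ℝ} {p q : ℝ → ℝ[X]} {M N : ℕ} (hp : ∀ τ, (p τ).natDegree < M)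
    (hq : ∀ τ, (q τ).natDegree < N) (hm : ∀ i, ContDiffWithinAt ℝ k (fun τ => m τ i) S t)
    (hp' : ∀ i, ContDiffWithinAt ℝ k (fun τ => (p τ).coeff i) S t)
    (hq' : ∀ i, ContDiffWithinAt ℝ k (fun τ => (q τ).coeff i) S t) :
    ContDiffWithinAt ℝ k (fun τ => momentFunctional (m τ) (p τ * q τ)) S t := by
  simp only [fun τ => momentFunctional_mul_eq_sum (m τ) (hp τ) (hq τ)]
  exact ContDiffWithinAt.sum fun i _ => ContDiffWithinAt.sum fun j _ =>
    ((hp' i).mul (hq' j)).mul (hm (i + j))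

theorem contDiffWithinAt_orthPoly_coeff_aux {k : WithTop ℕ∞} {S : Set ℝ} {t : ℝ}
    {m : ℝ → ℕ → ℝ} (hm : ∀ i, ContDiffWithinAt ℝ k (fun τ => m τ i) S t)
    (hpos : PosDefMoments (m t)) (n : ℕ) :
    (∀ i, ContDiffWithinAt ℝ k (fun τ => (orthPoly (m τ) n).coeff i) S t) ∧
    (∀ i, ContDiffWithinAt ℝ k (fun τ => (orthPrev (m τ) n).coeff i) S t) := by
  induction n with
  | zero =>
    simp only [orthPoly_zero, orthPrev_zero]
    exact ⟨fun i => contDiffWithinAt_const, fun i => contDiffWithinAt_const⟩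
  | succ n ih =>
    obtain ⟨ih1, ih2⟩ := ih
    refine ⟨fun i => ?_, ih1⟩
    have hdeg : ∀ τ, (orthPoly (m τ) n).natDegree < n + 1 := fun τ => by
      rw [orthPoly_natDegree]; exact Nat.lt_succ_self n
    have hnorm : ContDiffWithinAt ℝ k (fun τ => orthNorm (m τ) n) S t :=
      contDiffWithinAt_momentFunctional_mul hdeg hdeg hm ih1 ih1
    have hdiag : ContDiffWithinAt ℝ k (fun τ => recDiag (m τ) n) S t := by
      refine ContDiffWithinAt.div ?_ hnorm (orthNorm_pos hpos n).ne'
      simp only [fun τ => momentFunctional_X_mul (m := fun i => m τ (i + 1)) (m' := m τ)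
        (fun _ => rfl) (orthPoly (m τ) n * orthPoly (m τ) n)]
      exact contDiffWithinAt_momentFunctional_mul hdeg hdeg (fun i => hm (i + 1)) ih1 ih1
    have hoff : ContDiffWithinAt ℝ k (fun τ => recOff (m τ) n) S t := by
      rcases n with _ | n
      · simp only [recOff_zero]
        exact contDiffWithinAt_const
      · exact hnorm.div (contDiffWithinAt_momentFunctional_mul
          (fun τ => orthPrev_natDegree_lt (m τ) _) (fun τ => orthPrev_natDegree_lt (m τ) _)
          hm ih2 ih2) (orthNorm_pos hpos n).ne'
    simp only [orthPoly_succ, coeff_sub, sub_mul, coeff_C_mul]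
    refine ((?_ : ContDiffWithinAt ℝ k _ S t).sub (hdiag.mul (ih1 i))).sub (hoff.mul (ih2 i))
    rcases i with _ | i
    · simp only [coeff_X_mul_zero]
      exact contDiffWithinAt_const
    · simp only [coeff_X_mul]
      exact ih1 i

theorem contDiffWithinAt_orthPoly_coeff {k : WithTop ℕ∞} {S : Set ℝ} {t : ℝ} {m : ℝ → ℕ → ℝ}
    (hm : ∀ i, ContDiffWithinAt ℝ k (fun τ => m τ i) S t)
    (hpos : PosDefMoments (m t)) (n : ℕ) (i : ℕ) :
    ContDiffWithinAt ℝ k (fun τ => (orthPoly (m τ) n).coeff i) S t :=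
  (contDiffWithinAt_orthPoly_coeff_aux hm hpos n).1 i

theorem contDiffWithinAt_orthNorm {k : WithTop ℕ∞} {S : Set ℝ} {t : ℝ} {m : ℝ → ℕ → ℝ}
    (hm : ∀ i, ContDiffWithinAt ℝ k (fun τ => m τ i) S t)
    (hpos : PosDefMoments (m t)) (n : ℕ) :
    ContDiffWithinAt ℝ k (fun τ => orthNorm (m τ) n) S t :=
  contDiffWithinAt_momentFunctional_mul (M := n + 1) (N := n + 1)
    (fun τ => by rw [orthPoly_natDegree]; exact Nat.lt_succ_self n)
    (fun τ => by rw [orthPoly_natDegree]; exact Nat.lt_succ_self n) hm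
    (contDiffWithinAt_orthPoly_coeff hm hpos n) (contDiffWithinAt_orthPoly_coeff hm hpos n)

theorem contDiffWithinAt_invDiag {k : WithTop ℕ∞} {S : Set ℝ} {t : ℝ} {m m' : ℝ → ℕ → ℝ}
    (hm : ∀ i, ContDiffWithinAt ℝ k (fun τ => m τ i) S t)
    (hm' : ∀ i, ContDiffWithinAt ℝ k (fun τ => m' τ i) S t)
    (hpos : PosDefMoments (m t)) (n : ℕ) :
    ContDiffWithinAt ℝ k (fun τ => invDiag (m τ) (m' τ) n) S t :=
  (contDiffWithinAt_momentFunctional_mul (M := n + 1) (N := n + 1)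
    (fun τ => by rw [orthPoly_natDegree]; exact Nat.lt_succ_self n)
    (fun τ => by rw [orthPoly_natDegree]; exact Nat.lt_succ_self n) hm'
    (contDiffWithinAt_orthPoly_coeff hm hpos n)
    (contDiffWithinAt_orthPoly_coeff hm hpos n)).div
    (contDiffWithinAt_orthNorm hm hpos n) (orthNorm_pos hpos n).ne'

theorem contDiffWithinAt_invOff_succ {k : WithTop ℕ∞} {S : Set ℝ} {t : ℝ} {m m' : ℝ → ℕ → ℝ}
    (hm : ∀ i, ContDiffWithinAt ℝ k (fun τ => m τ i) S t)
    (hm' : ∀ i, ContDiffWithinAt ℝ k (fun τ => m' τ i) S t)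
    (hpos : PosDefMoments (m t)) (n : ℕ) :
    ContDiffWithinAt ℝ k (fun τ => invOff (m τ) (m' τ) (n + 1)) S t :=
  (contDiffWithinAt_momentFunctional_mul (M := n + 2) (N := n + 1)
    (fun τ => by rw [orthPoly_natDegree]; exact Nat.lt_succ_self _)
    (fun τ => by rw [orthPoly_natDegree]; exact Nat.lt_succ_self n) hm'
    (contDiffWithinAt_orthPoly_coeff hm hpos (n + 1))
    (contDiffWithinAt_orthPoly_coeff hm hpos n)).div
    (contDiffWithinAt_orthNorm hm hpos n) (orthNorm_pos hpos n).ne'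

theorem hasDerivAt_momentFunctional_mul {t : ℝ} {m : ℝ → ℕ → ℝ} {m' : ℕ → ℝ} {p q : ℝ → ℝ[X]}
    {p' q' : ℝ[X]} {M N : ℕ} (hp : ∀ τ, (p τ).natDegree < M) (hq : ∀ τ, (q τ).natDegree < N)
    (hpd : p'.natDegree < M) (hqd : q'.natDegree < N)
    (hm : ∀ i, HasDerivAt (fun τ => m τ i) (-m' i) t)
    (hp' : ∀ i, HasDerivAt (fun τ => (p τ).coeff i) (p'.coeff i) t)
    (hq' : ∀ i, HasDerivAt (fun τ => (q τ).coeff i) (q'.coeff i) t) :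
    HasDerivAt (fun τ => momentFunctional (m τ) (p τ * q τ))
      (momentFunctional (m t) (p' * q t) + momentFunctional (m t) (p t * q')
        - momentFunctional m' (p t * q t)) t := by
  simp only [fun τ => momentFunctional_mul_eq_sum (m τ) (hp τ) (hq τ)]
  rw [momentFunctional_mul_eq_sum _ hpd (hq t), momentFunctional_mul_eq_sum _ (hp t) hqd,
    momentFunctional_mul_eq_sum _ (hp t) (hq t)]
  simp only [← Finset.sum_add_distrib, ← Finset.sum_sub_distrib]
  refine HasDerivAt.fun_sum fun i _ => HasDerivAt.fun_sum fun j _ => ?_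
  refine (((hp' i).fun_mul (hq' j)).fun_mul (hm (i + j))).congr_deriv ?_
  ring

theorem exists_orthPoly_hasDerivAt_coeff {t : ℝ} {m : ℝ → ℕ → ℝ}
    (hc : ∀ i, ContDiffAt ℝ 1 (fun τ => m τ i) t) (hpos : PosDefMoments (m t)) (n : ℕ) :
    ∃ p' : ℝ[X], p'.degree < n ∧
    ∀ i, HasDerivAt (fun τ => (orthPoly (m τ) n).coeff i) (p'.coeff i) t := by
  refine ⟨∑ i ∈ Finset.range n, monomial i (deriv (fun τ => (orthPoly (m τ) n).coeff i) t),
    ?_, fun i => ?_⟩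
  · rw [degree_lt_iff_coeff_zero]
    intro i hi
    simp only [finsetSum_coeff, coeff_monomial]
    exact Finset.sum_eq_zero fun j hj => if_neg (by simp at hj; lia)
  · simp only [finsetSum_coeff, coeff_monomial, Finset.sum_ite_eq', Finset.mem_range]
    split_ifs with h
    · have := contDiffWithinAt_orthPoly_coeff (S := univ)
        (fun i => (hc i).contDiffWithinAt) hpos n i
      exact ((contDiffWithinAt_univ.1 this).differentiableAt one_ne_zero).hasDerivAt
    · rcases (not_lt.1 h).eq_or_lt with rfl | h
      · simpa only [orthPoly_coeff_self] using hasDerivAt_const t (1:ℝ)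
      · simpa only [fun τ => orthPoly_coeff_of_lt (m τ) h] using hasDerivAt_const t (0:ℝ)

theorem hasDerivAt_orthNorm {t : ℝ} {m : ℝ → ℕ → ℝ} {m' : ℕ → ℝ}
    (hm : ∀ i, HasDerivAt (fun τ => m τ i) (-m' i) t)
    (hc : ∀ i, ContDiffAt ℝ 1 (fun τ => m τ i) t)
    (hpos : PosDefMoments (m t)) (n : ℕ) :
    HasDerivAt (fun τ => orthNorm (m τ) n)
    (-momentFunctional m' (orthPoly (m t) n * orthPoly (m t) n)) t := by
  obtain ⟨p', hd, hp'⟩ := exists_orthPoly_hasDerivAt_coeff hc hpos n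
  have hN : ∀ τ, (orthPoly (m τ) n).natDegree < n + 1 := fun τ => by
    rw [orthPoly_natDegree]; exact Nat.lt_succ_self n
  have hN' : p'.natDegree < n + 1 := by
    have := natDegree_le_of_degree_le hd.le
    lia
  refine (hasDerivAt_momentFunctional_mul hN hN hN' hN' hm hp' hp').congr_deriv ?_
  rw [mul_comm p', momentFunctional_orthPoly_mul_of_lt hpos hd]
  ring

theorem hasDerivAt_orthPoly_succ_coeff {t : ℝ} {m : ℝ → ℕ → ℝ} {m' : ℕ → ℝ}
    (hm : ∀ i, HasDerivAt (fun τ => m τ i) (-m' i) t)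
    (hc : ∀ i, ContDiffAt ℝ 1 (fun τ => m τ i) t)
    (hev : ∀ᶠ τ in 𝓝 t, PosDefMoments (m τ)) (n : ℕ) :
    HasDerivAt (fun τ => (orthPoly (m τ) (n + 1)).coeff n) (invOff (m t) m' (n + 1)) t := by
  have hpos := hev.self_of_nhds
  obtain ⟨p', hpd, hp'⟩ := exists_orthPoly_hasDerivAt_coeff hc hpos (n + 1)
  obtain ⟨q', hqd, hq'⟩ := exists_orthPoly_hasDerivAt_coeff hc hpos n
  have hN : ∀ j τ, (orthPoly (m τ) j).natDegree < j + 1 := fun j τ => by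
    rw [orthPoly_natDegree]; exact Nat.lt_succ_self j
  have hpN : p'.natDegree < n + 1 + 1 := by
    have := natDegree_le_of_degree_le hpd.le
    lia
  have hqN : q'.natDegree < n + 1 := by
    have := natDegree_le_of_degree_le hqd.le
    lia
  have h := hasDerivAt_momentFunctional_mul (hN (n + 1)) (hN n) hpN hqN hm hp' hq'
  have horth : (fun τ => momentFunctional (m τ) (orthPoly (m τ) (n + 1) * orthPoly (m τ) n))
      =ᶠ[𝓝 t] fun _ => 0 :=
    hev.mono fun τ hτ => momentFunctional_orthPoly_orthPoly hτ (by lia)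
  have h0 := h.unique ((hasDerivAt_const t (0:ℝ)).congr_of_eventuallyEq horth)
  rw [mul_comm p', momentFunctional_orthPoly_mul hpos hpd, momentFunctional_orthPoly_mul_of_lt hpos
    (hqd.trans (by exact_mod_cast Nat.lt_succ_self n))] at h0
  refine (hp' n).congr_deriv ?_
  rw [invOff, orthNormPrev_succ, orthPrev_succ, eq_div_iff (orthNorm_pos hpos n).ne']
  linarith

end Regularity

section PerturbedLaguerre

open Polynomial

/-- The sequence of moments `∫_0^∞ x^{α+i} e^{-x-t/x} dx`. -/
noncomputable def pertMoments (α t : ℝ) (i : ℕ) : ℝ := realMoment (α + i) t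

theorem pertMoments_sub_one_succ (α t : ℝ) (i : ℕ) :
    pertMoments (α - 1) t (i + 1) = pertMoments α t i := by
  rw [pertMoments, pertMoments]
  congr 1
  push_cast
  ring

theorem pertLagMoment_eq (α t : ℝ) (i : ℕ) : pertLagMoment α t i = pertMoments α t i := by
  refine setIntegral_congr_fun measurableSet_Ioi fun x (hx : 0 < x) => ?_
  simp only [pertLagWeight]
  rw [Real.rpow_add hx, Real.rpow_natCast]
  ring

theorem integrableOn_eval_mul {α t : ℝ} (h : 0 < t ∨ 0 ≤ t ∧ -1 < α) (p : ℝ[X]) :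
    IntegrableOn (fun x => p.eval x * (x ^ α * Real.exp (-x - t / x))) (Ioi 0) ∧
    ∫ x in Ioi (0:ℝ), p.eval x * (x ^ α * Real.exp (-x - t / x))
      = momentFunctional (pertMoments α t) p := by
  induction p using Polynomial.induction_on' with
  | add p q hp hq =>
    simp only [eval_add, add_mul, map_add]
    exact ⟨hp.1.add hq.1, by rw [integral_add hp.1 hq.1, hp.2, hq.2]⟩
  | monomial i c =>
    have hi : IntegrableOn (fun x : ℝ => x ^ (α + i) * Real.exp (-x - t / x)) (Ioi 0) :=
      integrableOn_rpow_mul_exp (h.imp_right fun h => ⟨h.1, by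
        have : (0:ℝ) ≤ i := i.cast_nonneg
        linarith [h.2]⟩)
    have heq : EqOn (fun x => c * (x ^ (α + i) * Real.exp (-x - t / x)))
        (fun x => (monomial i c).eval x * (x ^ α * Real.exp (-x - t / x))) (Ioi 0) := by
      intro x (hx : 0 < x)
      simp only [eval_monomial]
      rw [Real.rpow_add hx, Real.rpow_natCast]
      ring
    refine ⟨IntegrableOn.congr_fun (hi.const_mul c) heq measurableSet_Ioi, ?_⟩
    rw [← setIntegral_congr_fun measurableSet_Ioi heq, integral_const_mul,
      momentFunctional_monomial]
    rfl

theorem posDefMoments_pertMoments {α t : ℝ} (h : 0 < t ∨ 0 ≤ t ∧ -1 < α) :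
    PosDefMoments (pertMoments α t) := by
  intro p hp
  obtain ⟨hi, he⟩ := integrableOn_eval_mul h (p * p)
  rw [← he, setIntegral_pos_iff_support_of_nonneg_ae _ hi]
  · have hsub : Ioi (0:ℝ) \ {x | p.IsRoot x} ⊆ (Function.support fun x =>
        (p * p).eval x * (x ^ α * Real.exp (-x - t / x))) ∩ Ioi 0 := by
      rintro x ⟨hx : 0 < x, hroot⟩
      refine ⟨?_, hx⟩
      have : p.eval x ≠ 0 := hroot
      have hw : 0 < x ^ α * Real.exp (-x - t / x) := by positivity
      rw [Function.mem_support, eval_mul]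
      exact mul_ne_zero (mul_ne_zero this this) hw.ne'
    refine lt_of_lt_of_le ?_ (measure_mono hsub)
    rw [measure_sdiff_null ((finite_setOfPred_isRoot hp).measure_zero volume), Real.volume_Ioi]
    exact ENNReal.zero_lt_top
  · refine (ae_restrict_mem measurableSet_Ioi).mono fun x (hx : 0 < x) => ?_
    simp only [eval_mul, Pi.zero_apply]
    have := mul_self_nonneg (p.eval x)
    positivity

theorem hasDerivAt_pertMoments (α : ℝ) {t : ℝ} (ht : 0 < t) (i : ℕ) :
    HasDerivAt (fun τ => pertMoments α τ i) (-pertMoments (α - 1) t i) t := by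
  refine (hasDerivAt_realMoment (α + i) ht).congr_deriv ?_
  rw [pertMoments]
  ring_nf

theorem contDiffOn_pertMoments (α : ℝ) (i : ℕ) :
    ContDiffOn ℝ 1 (fun τ => pertMoments α τ i) (Ioi 0) := by
  rw [show (1 : WithTop ℕ∞) = 0 + 1 from (zero_add _).symm,
    contDiffOn_succ_iff_deriv_of_isOpen isOpen_Ioi]
  refine ⟨fun t ht => (hasDerivAt_pertMoments α ht i).differentiableAt.differentiableWithinAt,
    by simp, ?_⟩
  rw [contDiffOn_zero]
  refine ContinuousOn.congr (f := fun t => -pertMoments (α - 1) t i) (fun t ht => ?_)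
    fun t ht => (hasDerivAt_pertMoments α ht i).deriv
  exact (hasDerivAt_pertMoments (α - 1) ht i).continuousAt.neg.continuousWithinAt

theorem contDiffAt_pertMoments (α : ℝ) {t : ℝ} (ht : 0 < t) (i : ℕ) :
    ContDiffAt ℝ 1 (fun τ => pertMoments α τ i) t :=
  (contDiffOn_pertMoments α i).contDiffAt (Ioi_mem_nhds ht)

theorem contDiffWithinAt_pertMoments_zero {α : ℝ} (hα : -1 < α) (i : ℕ) :
    ContDiffWithinAt ℝ 0 (fun τ => pertMoments α τ i) (Ici 0) 0 := by
  refine contDiffOn_zero.2 (fun t ht => ?_) 0 self_mem_Ici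
  rcases (mem_Ici.1 ht).eq_or_lt with rfl | ht
  · exact continuousWithinAt_realMoment (by
      have : (0:ℝ) ≤ i := i.cast_nonneg
      linarith)
  · exact (hasDerivAt_pertMoments α ht i).continuousAt.continuousWithinAt

theorem pertMoments_recurrence (α : ℝ) {t : ℝ} (ht : 0 < t) (i : ℕ) :
    (i + 1 + α) * pertMoments α t i - pertMoments α t (i + 1) + t * pertMoments (α - 1) t i
      = 0 := by
  rw [← realMoment_recurrence (α + i) ht, pertMoments, pertMoments, pertMoments]
  push_cast
  ring_nf

theorem pertMoments_zero_recurrence {α : ℝ} (hα : 0 < α) (i : ℕ) :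
    (i + α) * pertMoments (α - 1) 0 i = pertMoments α 0 i := by
  have h := realMoment_zero_recurrence (s := α - 1 + i) (by
    have : (0:ℝ) ≤ i := i.cast_nonneg
    linarith)
  rw [pertMoments, pertMoments]
  convert h using 2 <;> ring

theorem hankelDet_eq_prod {α t : ℝ} (ht : 0 < t) (n : ℕ) :
    hankelDet α n t = ∏ i ∈ Finset.range n, orthNorm (pertMoments α t) i := by
  rw [← hankel_det_eq_prod_orthNorm (posDefMoments_pertMoments (Or.inl ht)), hankelDet]
  simp only [pertLagMoment_eq]

theorem Hlog_eq_sum (α : ℝ) {t : ℝ} (ht : 0 < t) (n : ℕ) :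
    Hlog α n t
      = -(t * ∑ j ∈ Finset.range n, invDiag (pertMoments α t) (pertMoments (α - 1) t) j) := by
  have hpos : ∀ τ > (0:ℝ), PosDefMoments (pertMoments α τ) :=
    fun τ hτ => posDefMoments_pertMoments (Or.inl hτ)
  have hev : (fun τ => Real.log (hankelDet α n τ)) =ᶠ[𝓝 t]
      fun τ => ∑ j ∈ Finset.range n, Real.log (orthNorm (pertMoments α τ) j) := by
    filter_upwards [Ioi_mem_nhds ht] with τ hτ
    rw [hankelDet_eq_prod hτ, Real.log_prod fun j _ => (orthNorm_pos (hpos τ hτ) j).ne']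
  have hd : HasDerivAt (fun τ => ∑ j ∈ Finset.range n, Real.log (orthNorm (pertMoments α τ) j))
      (∑ j ∈ Finset.range n, -invDiag (pertMoments α t) (pertMoments (α - 1) t) j) t := by
    refine HasDerivAt.fun_sum fun j _ => ?_
    refine ((hasDerivAt_orthNorm (fun i => hasDerivAt_pertMoments α ht i)
      (contDiffAt_pertMoments α ht) (hpos t ht) j).log (orthNorm_pos (hpos t ht) j).ne').congr_deriv
      ?_
    rw [invDiag, neg_div]
  rw [Hlog, hev.deriv_eq, hd.deriv, Finset.sum_neg_distrib, mul_neg]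

theorem sum_recDiag_eq (α : ℝ) {t : ℝ} (ht : 0 < t) (n : ℕ) :
    ∑ j ∈ Finset.range n, recDiag (pertMoments α t) j = n * (n + α) - Hlog α n t := by
  have hpos : PosDefMoments (pertMoments α t) := posDefMoments_pertMoments (Or.inl ht)
  rw [Hlog_eq_sum α ht]
  induction n with
  | zero => simp
  | succ n ih =>
    rw [Finset.sum_range_succ, Finset.sum_range_succ, ih,
      recDiag_eq hpos (pertMoments_recurrence α ht)]
    push_cast
    ring

theorem recOff_succ_eq_Hlog (α : ℝ) {t : ℝ} (ht : 0 < t) (n : ℕ) :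
    recOff (pertMoments α t) (n + 1) = ((n + 1 : ℕ) : ℝ) * ((n + 1 : ℕ) + α) - Hlog α (n + 1) t
      + t * invOff (pertMoments α t) (pertMoments (α - 1) t) (n + 1) := by
  rw [recOff_succ_eq (posDefMoments_pertMoments (Or.inl ht)) (pertMoments_recurrence α ht),
    sum_recDiag_eq α ht]

theorem hasDerivAt_Hlog (α : ℝ) {t : ℝ} (ht : 0 < t) (n : ℕ) :
    HasDerivAt (Hlog α (n + 1))
      (invOff (pertMoments α t) (pertMoments (α - 1) t) (n + 1)) t := by
  have hev : Hlog α (n + 1) =ᶠ[𝓝 t] fun τ => ((n + 1 : ℕ) : ℝ) * ((n + 1 : ℕ) + α)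
      + (orthPoly (pertMoments α τ) (n + 1)).coeff n := by
    filter_upwards [Ioi_mem_nhds ht] with τ hτ
    rw [orthPoly_succ_coeff, sum_recDiag_eq α hτ]
    ring
  refine HasDerivAt.congr_of_eventuallyEq (HasDerivAt.const_add _ ?_) hev
  refine hasDerivAt_orthPoly_succ_coeff (fun i => hasDerivAt_pertMoments α ht i)
    (contDiffAt_pertMoments α ht) ?_ n
  filter_upwards [Ioi_mem_nhds ht] with τ hτ
  exact posDefMoments_pertMoments (Or.inl hτ)

theorem hasDerivAt_recOff_succ (α : ℝ) {t : ℝ} (ht : 0 < t) (n : ℕ) :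
    HasDerivAt (fun τ => recOff (pertMoments α τ) (n + 1))
      (recOff (pertMoments α t) (n + 1)
        * (invDiag (pertMoments α t) (pertMoments (α - 1) t) n
          - invDiag (pertMoments α t) (pertMoments (α - 1) t) (n + 1))) t := by
  have hpos : PosDefMoments (pertMoments α t) := posDefMoments_pertMoments (Or.inl ht)
  have hd := hasDerivAt_orthNorm (fun i => hasDerivAt_pertMoments α ht i)
      (contDiffAt_pertMoments α ht) hpos
  have h0 := (orthNorm_pos hpos n).ne'
  have h1 := (orthNorm_pos hpos (n + 1)).ne'
  refine ((hd (n + 1)).fun_div (hd n) h0).congr_deriv ?_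
  rw [recOff, invDiag, invDiag, orthNormPrev_succ]
  field_simp
  ring

theorem hasDerivAt_invOff_succ (α : ℝ) {t : ℝ} (ht : 0 < t) (n : ℕ) :
    HasDerivAt (fun τ => invOff (pertMoments α τ) (pertMoments (α - 1) τ) (n + 1))
      (recOff (pertMoments α t) (n + 1)
        * (invDiag (pertMoments α t) (pertMoments (α - 1) t) n
          - invDiag (pertMoments α t) (pertMoments (α - 1) t) (n + 1)) / t) t := by
  have hev : (fun τ => invOff (pertMoments α τ) (pertMoments (α - 1) τ) (n + 1)) =ᶠ[𝓝 t]
      fun τ => (recOff (pertMoments α τ) (n + 1) - (((n + 1 : ℕ) : ℝ) * ((n + 1 : ℕ) + α)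
        - Hlog α (n + 1) τ)) / τ := by
    filter_upwards [Ioi_mem_nhds ht] with τ hτ
    rw [recOff_succ_eq_Hlog α hτ, add_sub_cancel_left, mul_div_cancel_left₀ _ (ne_of_gt hτ)]
  refine HasDerivAt.congr_of_eventuallyEq ?_ hev
  refine (((hasDerivAt_recOff_succ α ht n).fun_sub ((hasDerivAt_Hlog α ht n).const_sub _)).fun_div
    (hasDerivAt_id' t) ht.ne').congr_deriv ?_
  have e := recOff_succ_eq_Hlog α ht n
  field_simp
  linear_combination -e

theorem deriv_Hlog_eventuallyEq (α : ℝ) {t : ℝ} (ht : 0 < t) (n : ℕ) :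
    deriv (Hlog α (n + 1)) =ᶠ[𝓝 t]
      fun τ => invOff (pertMoments α τ) (pertMoments (α - 1) τ) (n + 1) := by
  filter_upwards [Ioi_mem_nhds ht] with τ hτ
  exact (hasDerivAt_Hlog α hτ n).deriv

end PerturbedLaguerre

/-- Chen–Its: For every integer `n ≥ 1` and `α > 0`, the function
`H_n(t) = t (d/dt) ln D_n[w;t]` is twice continuously differentiable on `(0,∞)` and
satisfies the Jimbo–Miwa–Okamoto σ-form
`(t H_n'')² = (n - (2n+α) H_n')² - 4 (n(n+α) + t H_n' - H_n) H_n' (H_n' - 1)`,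
with `H_n(t) → 0` and `H_n'(t) → -n/α` as `t → 0⁺`. -/
theorem chen_its_sigma_form (α : ℝ) (hα : 0 < α) (n : ℕ) (hn : 1 ≤ n) :
    ContDiffOn ℝ 2 (Hlog α n) (Ioi (0:ℝ)) ∧
    (∀ t > (0:ℝ),
      (t * deriv (deriv (Hlog α n)) t) ^ 2
        = ((n : ℝ) - (2 * n + α) * deriv (Hlog α n) t) ^ 2
          - 4 * ((n : ℝ) * (n + α) + t * deriv (Hlog α n) t - Hlog α n t)
              * deriv (Hlog α n) t * (deriv (Hlog α n) t - 1)) ∧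
    Tendsto (Hlog α n) (𝓝[>] (0:ℝ)) (𝓝 0) ∧
    Tendsto (deriv (Hlog α n)) (𝓝[>] (0:ℝ)) (𝓝 (-(n : ℝ) / α)) := by
  obtain ⟨N, rfl⟩ : ∃ N, n = N + 1 := ⟨n - 1, by lia⟩
  have hα' : -1 < α - 1 := by linarith
  have hpos0 : PosDefMoments (pertMoments α 0) :=
    posDefMoments_pertMoments (Or.inr ⟨le_rfl, by linarith⟩)
  have hm0 := contDiffWithinAt_pertMoments_zero (α := α) (by linarith)
  have hm0' := contDiffWithinAt_pertMoments_zero hα'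
  have hH'' : ∀ t > (0:ℝ), HasDerivAt (deriv (Hlog α (N + 1)))
      (recOff (pertMoments α t) (N + 1)
        * (invDiag (pertMoments α t) (pertMoments (α - 1) t) N
          - invDiag (pertMoments α t) (pertMoments (α - 1) t) (N + 1)) / t) t :=
    fun t ht => (hasDerivAt_invOff_succ α ht N).congr_of_eventuallyEq
      (deriv_Hlog_eventuallyEq α ht N)
  refine ⟨?_, fun t ht => ?_, ?_, ?_⟩
  · have hcd : ContDiffOn ℝ 1 (deriv (Hlog α (N + 1))) (Ioi 0) := fun t ht =>
      ((contDiffWithinAt_univ.1 (contDiffWithinAt_invOff_succ (S := univ)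
        (fun i => (contDiffAt_pertMoments α ht i).contDiffWithinAt)
        (fun i => (contDiffAt_pertMoments (α - 1) ht i).contDiffWithinAt)
        (posDefMoments_pertMoments (Or.inl ht)) N)).congr_of_eventuallyEq
        (deriv_Hlog_eventuallyEq α ht N)).contDiffWithinAt
    rw [show (2 : WithTop ℕ∞) = 1 + 1 from one_add_one_eq_two.symm,
      contDiffOn_succ_iff_deriv_of_isOpen isOpen_Ioi]
    exact ⟨fun t ht => (hasDerivAt_Hlog α ht N).differentiableAt.differentiableWithinAt,
      by simp, hcd⟩
  · have hpos : PosDefMoments (pertMoments α t) := posDefMoments_pertMoments (Or.inl ht)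
    have hpos' : PosDefMoments (pertMoments (α - 1) t) := posDefMoments_pertMoments (Or.inl ht)
    have hshift := pertMoments_sub_one_succ α t
    have e1 := recOff_mul_invDiag_mul_invDiag hpos hshift N
    have e2 := recOff_mul_invDiag_add hpos hshift
      (fun j => (div_pos (hpos' _ (orthPoly_monic _ j).ne_zero) (orthNorm_pos hpos j)).ne')
      (pertMoments_recurrence α ht) (N + 1)
    have e3 := recOff_succ_eq_Hlog α ht N
    rw [invDiagPrev_succ] at e2
    rw [(hH'' t ht).deriv, (hasDerivAt_Hlog α ht N).deriv, mul_div_cancel₀ _ ht.ne', ← e2,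
      show ((N + 1 : ℕ) : ℝ) * ((N + 1 : ℕ) + α) + t * invOff (pertMoments α t)
        (pertMoments (α - 1) t) (N + 1) - Hlog α (N + 1) t = recOff (pertMoments α t) (N + 1) by
        rw [e3]; ring]
    linear_combination -4 * recOff (pertMoments α t) (N + 1) * e1
  · have hc : ContinuousWithinAt (fun t => -(t * ∑ j ∈ Finset.range (N + 1),
        invDiag (pertMoments α t) (pertMoments (α - 1) t) j)) (Ici 0) 0 :=
      ((contDiffWithinAt_id (n := 0)).mul (ContDiffWithinAt.sum fun j _ =>
        contDiffWithinAt_invDiag hm0 hm0' hpos0 j)).neg.continuousWithinAt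
    have hlim := hc.tendsto.mono_left (nhdsWithin_mono 0 Ioi_subset_Ici_self)
    simp only [zero_mul, neg_zero] at hlim
    refine hlim.congr' ?_
    filter_upwards [self_mem_nhdsWithin] with t ht
    exact (Hlog_eq_sum α ht (N + 1)).symm
  · have hc := (contDiffWithinAt_invOff_succ hm0 hm0' hpos0 N).continuousWithinAt
    have hlim := hc.tendsto.mono_left (nhdsWithin_mono 0 Ioi_subset_Ici_self)
    rw [invOff_succ_of_gamma hpos0 (pertMoments_sub_one_succ α 0) hα.ne'
      (pertMoments_zero_recurrence hα)] at hlim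
    refine hlim.congr' ?_
    filter_upwards [self_mem_nhdsWithin] with t ht
    exact (hasDerivAt_Hlog α ht N).deriv.symm
end
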